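/- Let n ≥ 1, I₀ = [−1,1], J ⊂ I₀ a closed interval with dist(J, ∂I₀) comparable to its length ℓ(J). Let u(z) = ω_{I₀}^z(J) be harmonic measure of J for ℂ \ I₀, let Ĩ₀ = I₀ × ℝ^{n−1} × {0} ⊂ ℝ^{n+1}, and define f(x₁,…,x_{n+1}) = u(x₁, x_{n+1}). Then f is a nonnegative bounded harmonic function on ℝ^{n+1} \ Ĩ₀ extending continuously to 0 on Ĩ₀ \ closure(J̃) and to 1 on J° × ℝ^{n−1} × {0}, where J̃ = J × ℝ^{n−1} × {0}; hence f(x) equals the harmonic measure ω̃^x(J̃) for ℝ^{n+1} \ Ĩ₀. -/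

import Mathlib

open Set Metric MeasureTheory ENNReal Filter Real

noncomputable section

/-- A function `f : ℂ → ℝ` is harmonic on `s ⊆ ℂ`: it is `C²` there and
`∂²f/∂x² + ∂²f/∂y² = 0`. -/
def HarmonicOnC (f : ℂ → ℝ) (s : Set ℂ) : Prop :=
  ContDiffOn ℝ 2 f s ∧
  ∀ z ∈ s,
    fderiv ℝ (fun w => fderiv ℝ f w 1) z 1 +
      fderiv ℝ (fun w => fderiv ℝ f w Complex.I) z Complex.I = 0

/-- `ω` is the harmonic measure of the planar open set `Ω` with pole `p ∈ Ω`: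
a (sub)probability measure carried by `∂Ω` reproducing at `p` the boundary values of
bounded harmonic functions. -/
def IsHarmonicMeasurePoleC (Ω : Set ℂ) (p : ℂ) (ω : Measure ℂ) : Prop :=
  ω (frontier Ω)ᶜ = 0 ∧ ω Set.univ ≤ 1 ∧
  ∀ f : ℂ → ℝ, Continuous f → Bornology.IsBounded (Set.range f) → HarmonicOnC f Ω →
    f p = ∫ z, f z ∂ω

/-- `ω` is the harmonic measure of the planar open set `Ω` with pole at infinity:
a probability measure carried by `∂Ω` reproducing at `∞` the boundary values of
harmonic functions having a limit at infinity. -/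
def IsHarmonicMeasureInftyC (Ω : Set ℂ) (ω : Measure ℂ) : Prop :=
  ω (frontier Ω)ᶜ = 0 ∧ IsProbabilityMeasure ω ∧
  ∀ (f : ℂ → ℝ) (L : ℝ), Continuous f → HarmonicOnC f Ω →
    Tendsto f (Bornology.cobounded ℂ) (nhds L) →
    L = ∫ z, f z ∂ω

/-- A function is harmonic on a set `s ⊆ ℝ^m`. -/
def IsHarmonicOn {m : ℕ} (f : EuclideanSpace ℝ (Fin m) → ℝ)
    (s : Set (EuclideanSpace ℝ (Fin m))) : Prop :=
  ContDiffOn ℝ 2 f s ∧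
  ∀ x ∈ s,
    ∑ i : Fin m,
      fderiv ℝ (fun y => fderiv ℝ f y (EuclideanSpace.single i 1)) x
        (EuclideanSpace.single i 1) = 0

/-- `ω` is the harmonic measure of the open set `Ω ⊆ ℝ^m` with pole `p ∈ Ω`. -/
def IsHarmonicMeasure {m : ℕ} (Ω : Set (EuclideanSpace ℝ (Fin m)))
    (p : EuclideanSpace ℝ (Fin m)) (ω : Measure (EuclideanSpace ℝ (Fin m))) : Prop :=
  ω (frontier Ω)ᶜ = 0 ∧ ω Set.univ ≤ 1 ∧
  ∀ f : EuclideanSpace ℝ (Fin m) → ℝ, Continuous f → Bornology.IsBounded (Set.range f) →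
    IsHarmonicOn f Ω →
    (3 ≤ m → Tendsto f (Bornology.cobounded (EuclideanSpace ℝ (Fin m))) (nhds 0)) →
    f p = ∫ x, f x ∂ω

/-- The segment `[-1, 1]` in the complex plane. -/
def slit : Set ℂ := (fun t : ℝ => (t : ℂ)) '' Set.Icc (-1 : ℝ) 1

lemma mem_slit_iff {z : ℂ} : z ∈ slit ↔ z.re ∈ Icc (-1 : ℝ) 1 ∧ z.im = 0 := by
  constructor
  · rintro ⟨t, ht, rfl⟩
    exact ⟨by simpa using ht, by simp⟩
  · rintro ⟨h1, h2⟩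
    exact ⟨z.re, h1, by apply Complex.ext <;> simp [h2]⟩

lemma isClosed_slit : IsClosed slit :=
  (isCompact_Icc.image Complex.continuous_ofReal).isClosed

lemma slit_eq_cos {z : ℂ} (hz : z ∈ slit) : ∃ φ : ℝ, z = (Real.cos φ : ℂ) := by
  obtain ⟨t, ht, rfl⟩ := hz
  exact ⟨Real.arccos t, by simp only [Real.cos_arccos ht.1 ht.2]⟩

lemma cos_mem_slit (θ : ℝ) : (Real.cos θ : ℂ) ∈ slit :=
  ⟨Real.cos θ, ⟨Real.neg_one_le_cos θ, Real.cos_le_one θ⟩, rfl⟩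

/-- A conformal map of `ℂ \ [-1, 1]` into the punctured unit disc, inverse to
`w ↦ (w + w⁻¹) / 2`. -/
def slitMap (z : ℂ) : ℂ :=
  (((z + 1) / (z - 1)) ^ (1 / 2 : ℂ) - 1) / (((z + 1) / (z - 1)) ^ (1 / 2 : ℂ) + 1)

lemma sub_one_ne_zero_of_notMem_slit {z : ℂ} (hz : z ∉ slit) : z - 1 ≠ 0 := by
  intro h
  apply hz
  rw [sub_eq_zero.1 h, mem_slit_iff]
  simp

lemma div_mem_slitPlane {z : ℂ} (hz : z ∉ slit) : (z + 1) / (z - 1) ∈ Complex.slitPlane := by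
  have h1 := sub_one_ne_zero_of_notMem_slit hz
  rw [Complex.mem_slitPlane_iff_not_le_zero]
  intro h
  apply hz
  obtain ⟨r, hr⟩ : ∃ r : ℝ, (z + 1) / (z - 1) = r :=
    ⟨((z + 1) / (z - 1)).re, by
      apply Complex.ext
      · simp
      · simpa using (Complex.le_def.1 h).2⟩
  rw [hr] at h
  have hr0 : r ≤ 0 := by exact_mod_cast h
  have hz2 : z * (r - 1) = r + 1 := by
    rw [div_eq_iff h1] at hr
    linear_combination -hr
  have hne : (r : ℂ) - 1 ≠ 0 := by
    have : r - 1 ≠ 0 := by linarith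
    exact_mod_cast this
  have hz3 : z = (((r + 1) / (r - 1) : ℝ) : ℂ) := by
    push_cast
    rw [eq_div_iff hne, hz2]
  refine ⟨_, ⟨?_, ?_⟩, hz3.symm⟩
  · rw [le_div_iff_of_neg (by linarith)]; linarith
  · rw [div_le_iff_of_neg (by linarith)]; linarith

lemma cpow_half_re_pos {x : ℂ} (hx : x ∈ Complex.slitPlane) : 0 < (x ^ (1 / 2 : ℂ)).re := by
  have h0 := Complex.slitPlane_ne_zero hx
  rw [Complex.cpow_def_of_ne_zero h0, Complex.exp_re]
  have harg : (Complex.log x * (1 / 2 : ℂ)).im = x.arg / 2 := by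
    have : (1 / 2 : ℂ) = ((1 / 2 : ℝ) : ℂ) := by push_cast; rfl
    rw [this, Complex.im_mul_ofReal, Complex.log_im]; ring
  rw [harg]
  have h1 := Complex.neg_pi_lt_arg x
  have h2 := Complex.arg_le_pi x
  have h3 := (Complex.mem_slitPlane_iff_arg.1 hx).1
  have h4 : x.arg < π := lt_of_le_of_ne h2 h3
  exact mul_pos (Real.exp_pos _) (Real.cos_pos_of_mem_Ioo ⟨by linarith, by linarith⟩)

lemma differentiableOn_slitMap : DifferentiableOn ℂ slitMap slitᶜ := by
  intro z hz
  have h1 := sub_one_ne_zero_of_notMem_slit hz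
  have h2 := div_mem_slitPlane hz
  have h3 := cpow_half_re_pos h2
  have h4 : ((z + 1) / (z - 1)) ^ (1 / 2 : ℂ) + 1 ≠ 0 := by
    intro h
    have := congrArg Complex.re h
    simp only [Complex.add_re, Complex.one_re, Complex.zero_re] at this
    linarith
  apply DifferentiableAt.differentiableWithinAt
  have h5 : DifferentiableAt ℂ (fun z : ℂ => ((z + 1) / (z - 1)) ^ (1 / 2 : ℂ)) z := by
    have h6 : DifferentiableAt ℂ (fun z : ℂ => (z + 1) / (z - 1)) z :=
      DifferentiableAt.div (by fun_prop) (by fun_prop) h1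
    exact h6.cpow (differentiableAt_const _) h2
  exact DifferentiableAt.div (h5.sub_const 1) (h5.add_const 1) h4

lemma norm_slitMap_lt_one {z : ℂ} (hz : z ∉ slit) : ‖slitMap z‖ < 1 := by
  have h3 := cpow_half_re_pos (div_mem_slitPlane hz)
  unfold slitMap
  set ζ := ((z + 1) / (z - 1)) ^ (1 / 2 : ℂ)
  have hlt : ‖ζ - 1‖ < ‖ζ + 1‖ := by
    rw [← sq_lt_sq₀ (norm_nonneg _) (norm_nonneg _), ← Complex.normSq_eq_norm_sq,
      ← Complex.normSq_eq_norm_sq, Complex.normSq_apply, Complex.normSq_apply]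
    simp only [Complex.sub_re, Complex.add_re, Complex.one_re, Complex.sub_im, Complex.add_im,
      Complex.one_im]
    nlinarith
  rw [norm_div, div_lt_one ((norm_nonneg _).trans_lt hlt)]
  exact hlt

lemma slitMap_ne_zero_and_eq {z : ℂ} (hz : z ∉ slit) :
    slitMap z ≠ 0 ∧ z = (slitMap z + (slitMap z)⁻¹) / 2 := by
  have h1 := sub_one_ne_zero_of_notMem_slit hz
  have h3 := cpow_half_re_pos (div_mem_slitPlane hz)
  have hsq : (((z + 1) / (z - 1)) ^ (1 / 2 : ℂ)) ^ 2 = (z + 1) / (z - 1) := by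
    have := Complex.cpow_nat_inv_pow ((z + 1) / (z - 1)) (n := 2) (by norm_num)
    rw [one_div]
    exact_mod_cast this
  unfold slitMap
  set ζ := ((z + 1) / (z - 1)) ^ (1 / 2 : ℂ)
  have h4 : ζ + 1 ≠ 0 := by
    intro h
    have := congrArg Complex.re h
    simp only [Complex.add_re, Complex.one_re, Complex.zero_re] at this
    linarith
  rw [eq_div_iff h1] at hsq
  have h5 : ζ - 1 ≠ 0 := by
    intro h
    rw [sub_eq_zero.1 h] at hsq
    have : (2 : ℂ) = 0 := by linear_combination -hsq
    norm_num at this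
  refine ⟨div_ne_zero h5 h4, ?_⟩
  field_simp
  linear_combination 2 * hsq

/-- The modulus of `slitMap`, extended continuously by `1` to the slit. -/
def slitMod (z : ℂ) : ℝ :=
  ((‖z - 1‖ + ‖z + 1‖) - √((‖z - 1‖ + ‖z + 1‖) ^ 2 - 4)) / 2

lemma continuous_slitMod : Continuous slitMod := by
  unfold slitMod
  fun_prop

lemma slitMod_eq_norm {z : ℂ} (hz : z ∉ slit) : slitMod z = ‖slitMap z‖ := by
  obtain ⟨h0, h1⟩ := slitMap_ne_zero_and_eq hz
  have hlt := norm_slitMap_lt_one hz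
  unfold slitMod
  set w := slitMap z
  have hw : 0 < ‖w‖ := norm_pos_iff.2 h0
  have e1 : z - 1 = (w - 1) ^ 2 / (2 * w) := by rw [h1]; field_simp; ring
  have e2 : z + 1 = (w + 1) ^ 2 / (2 * w) := by rw [h1]; field_simp; ring
  have e3 : ‖w - 1‖ ^ 2 + ‖w + 1‖ ^ 2 = 2 * ‖w‖ ^ 2 + 2 := by
    rw [← Complex.normSq_eq_norm_sq, ← Complex.normSq_eq_norm_sq, ← Complex.normSq_eq_norm_sq,
      Complex.normSq_apply, Complex.normSq_apply, Complex.normSq_apply]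
    simp only [Complex.sub_re, Complex.add_re, Complex.one_re, Complex.sub_im, Complex.add_im,
      Complex.one_im]
    ring
  have e4 : ‖z - 1‖ + ‖z + 1‖ = ‖w‖ + ‖w‖⁻¹ := by
    rw [e1, e2, norm_div, norm_div, norm_pow, norm_pow, norm_mul, ← add_div, e3]
    simp only [Complex.norm_ofNat]
    field_simp
  rw [e4]
  have e5 : (‖w‖ + ‖w‖⁻¹) ^ 2 - 4 = (‖w‖⁻¹ - ‖w‖) ^ 2 := by field_simp; ring
  have e6 : 0 ≤ ‖w‖⁻¹ - ‖w‖ := by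
    have := one_lt_inv_iff₀.2 ⟨hw, hlt⟩
    linarith
  rw [e5, Real.sqrt_sq e6]
  ring

lemma slitMod_eq_one {z : ℂ} (hz : z ∈ slit) : slitMod z = 1 := by
  obtain ⟨t, ht, rfl⟩ := hz
  have e1 : ‖((t : ℝ) : ℂ) - 1‖ = 1 - t := by
    have : ((t : ℝ) : ℂ) - 1 = ((t - 1 : ℝ) : ℂ) := by push_cast; rfl
    rw [this, Complex.norm_real, Real.norm_eq_abs, abs_of_nonpos (by linarith [ht.2])]; ring
  have e2 : ‖((t : ℝ) : ℂ) + 1‖ = t + 1 := by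
    have : ((t : ℝ) : ℂ) + 1 = ((t + 1 : ℝ) : ℂ) := by push_cast; rfl
    rw [this, Complex.norm_real, Real.norm_eq_abs, abs_of_nonneg (by linarith [ht.1])]
  unfold slitMod
  simp only [e1, e2]
  rw [show (1 - t + (t + 1)) ^ 2 - 4 = 0 by ring, Real.sqrt_zero]
  ring

/-- The bounded harmonic function off `[-1, 1]` with boundary values the Chebyshev polynomial
`T k`. -/
def chebHarm (k : ℕ) (z : ℂ) : ℝ :=
  2 * ((Polynomial.Chebyshev.T ℂ k).eval z).re * (slitMod z ^ (2 * k) / (1 + slitMod z ^ (2 * k)))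

lemma continuous_chebHarm (k : ℕ) : Continuous (chebHarm k) := by
  unfold chebHarm
  have := continuous_slitMod
  refine Continuous.mul (by fun_prop) (Continuous.div (by fun_prop) (by fun_prop) ?_)
  intro z
  have : 0 ≤ slitMod z ^ (2 * k) := by rw [pow_mul]; positivity
  positivity

lemma eval_T_eq {w : ℂ} (hw : w ≠ 0) (k : ℕ) :
    (Polynomial.Chebyshev.T ℂ k).eval ((w + w⁻¹) / 2) = (w ^ k + (w ^ k)⁻¹) / 2 := by
  have h : (w + w⁻¹) / 2 = Complex.cosh (Complex.log w) := by
    rw [Complex.cosh, Complex.exp_neg, Complex.exp_log hw]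
  rw [h, Polynomial.Chebyshev.T_complex_cosh, Complex.cosh, Complex.exp_neg]
  simp only [Int.cast_natCast]
  rw [Complex.exp_nat_mul, Complex.exp_log hw]

lemma chebHarm_eq_re {z : ℂ} (hz : z ∉ slit) (k : ℕ) : chebHarm k z = (slitMap z ^ k).re := by
  obtain ⟨h0, h1⟩ := slitMap_ne_zero_and_eq hz
  unfold chebHarm
  rw [slitMod_eq_norm hz]
  set w := slitMap z
  rw [h1, eval_T_eq h0, mul_comm 2 k, pow_mul, ← norm_pow]
  have hne : w ^ k ≠ 0 := pow_ne_zero _ h0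
  set W := w ^ k
  have hW : 0 < ‖W‖ := norm_pos_iff.2 hne
  have : ((W + W⁻¹) / 2).re = W.re * (1 + (‖W‖ ^ 2)⁻¹) / 2 := by
    have : (W + W⁻¹) / 2 = ((1 / 2 : ℝ) : ℂ) * (W + W⁻¹) := by push_cast; ring
    rw [this, Complex.re_ofReal_mul, Complex.add_re, Complex.inv_re, Complex.normSq_eq_norm_sq]
    ring
  rw [this]
  field_simp
  ring

lemma chebHarm_cos (k : ℕ) (φ : ℝ) : chebHarm k (Real.cos φ) = Real.cos (k * φ) := by
  unfold chebHarm
  rw [slitMod_eq_one (cos_mem_slit φ), Complex.ofReal_cos, Polynomial.Chebyshev.T_complex_cos]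
  have : Complex.cos (((k : ℤ) : ℂ) * φ) = ((Real.cos (k * φ) : ℝ) : ℂ) := by push_cast; rfl
  rw [this, Complex.ofReal_re]
  norm_num
  ring

lemma chebHarm_ofReal (k : ℕ) {t : ℝ} (ht : t ∈ Icc (-1 : ℝ) 1) :
    chebHarm k t = (Polynomial.Chebyshev.T ℝ k).eval t := by
  rw [← Real.cos_arccos ht.1 ht.2, chebHarm_cos, Polynomial.Chebyshev.T_real_cos]
  simp

lemma abs_chebHarm_le (k : ℕ) (z : ℂ) : |chebHarm k z| ≤ 1 := by
  by_cases hz : z ∈ slit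
  · obtain ⟨φ, rfl⟩ := slit_eq_cos hz
    rw [chebHarm_cos]
    exact Real.abs_cos_le_one _
  · rw [chebHarm_eq_re hz]
    refine (Complex.abs_re_le_norm _).trans ?_
    rw [norm_pow]
    exact pow_le_one₀ (norm_nonneg _) (norm_slitMap_lt_one hz).le

section Lift

variable {E : Type*} [NormedAddCommGroup E] [NormedSpace ℝ E]

/-- Second directional derivatives of the real part of a holomorphic function composed with a
real-linear map. -/
lemma contDiffOn_and_fderiv_fderiv_re_comp {g : ℂ → ℂ} {U : Set ℂ} (hU : IsOpen U)
    (hg : DifferentiableOn ℂ g U) (L : E →L[ℝ] ℂ) {f : E → ℝ} {V : Set E} (hV : IsOpen V)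
    (hVU : MapsTo L V U) (hf : ∀ x ∈ V, f x = (g (L x)).re) :
    ContDiffOn ℝ 2 f V ∧ ∀ x ∈ V, ∀ v,
      fderiv ℝ (fun y => fderiv ℝ f y v) x v = (deriv (deriv g) (L x) * (L v) ^ 2).re := by
  have hfirst : ∀ (g : ℂ → ℂ), DifferentiableOn ℂ g U → ∀ f : E → ℝ, ∀ c : ℂ,
      (∀ x ∈ V, f x = (g (L x) * c).re) → ∀ x ∈ V, ∀ v,
      fderiv ℝ f x v = (deriv g (L x) * L v * c).re := by
    intro g hg f c hf x hx v
    have h1 : HasDerivAt g (deriv g (L x)) (L x) :=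
      ((hg _ (hVU hx)).differentiableAt (hU.mem_nhds (hVU hx))).hasDerivAt
    have h2 : HasFDerivAt g ((ContinuousLinearMap.toSpanSingleton ℂ
        (deriv g (L x))).restrictScalars ℝ) (L x) := h1.hasFDerivAt.restrictScalars ℝ
    have h3 := ((h2.comp x L.hasFDerivAt).mul_const' c)
    have h4 := Complex.reCLM.hasFDerivAt.comp x h3
    have h5 : HasFDerivAt f _ x := h4.congr_of_eventuallyEq (by
      filter_upwards [hV.mem_nhds hx] with y hy
      simp [hf y hy])
    rw [h5.fderiv]
    simp
    ring_nf
  constructor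
  · have h1 : ContDiffOn ℝ 2 g U := (hg.contDiffOn hU).restrict_scalars ℝ
    have h2 : ContDiffOn ℝ 2 (fun x => (g (L x)).re) V :=
      Complex.reCLM.contDiff.comp_contDiffOn (h1.comp L.contDiff.contDiffOn hVU)
    exact h2.congr hf
  · intro x hx v
    have h := hfirst (deriv g) (hg.deriv hU) (fun y => fderiv ℝ f y v) (L v) (fun y hy => by
      rw [hfirst g hg f 1 (by simpa using hf) y hy v]; simp) x hx v
    rw [h]
    ring_nf

end Lift

lemma harmonicOnC_of_re {g : ℂ → ℂ} {U : Set ℂ} (hU : IsOpen U)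
    (hg : DifferentiableOn ℂ g U) {f : ℂ → ℝ} (hf : ∀ x ∈ U, f x = (g x).re) :
    HarmonicOnC f U := by
  obtain ⟨h1, h2⟩ := contDiffOn_and_fderiv_fderiv_re_comp hU hg (ContinuousLinearMap.id ℝ ℂ) hU
    (fun x hx => hx) hf
  refine ⟨h1, fun z hz => ?_⟩
  rw [h2 z hz, h2 z hz]
  simp

/-- The projection `x ↦ x₁ + i x_{n+1}`. -/
def planeProj (n : ℕ) : EuclideanSpace ℝ (Fin (n + 1)) →L[ℝ] ℂ :=
  (EuclideanSpace.proj (0 : Fin (n + 1)) : EuclideanSpace ℝ (Fin (n + 1)) →L[ℝ] ℝ).smulRight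
      (1 : ℂ) +
  (EuclideanSpace.proj (Fin.last n) : EuclideanSpace ℝ (Fin (n + 1)) →L[ℝ] ℝ).smulRight Complex.I

lemma planeProj_apply (n : ℕ) (x : EuclideanSpace ℝ (Fin (n + 1))) :
    planeProj n x = (x 0 : ℂ) + (x (Fin.last n) : ℂ) * Complex.I := by
  simp [planeProj]

lemma planeProj_re (n : ℕ) (x : EuclideanSpace ℝ (Fin (n + 1))) : (planeProj n x).re = x 0 := by
  simp [planeProj_apply]

lemma planeProj_im (n : ℕ) (x : EuclideanSpace ℝ (Fin (n + 1))) :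
    (planeProj n x).im = x (Fin.last n) := by
  simp [planeProj_apply]

lemma sum_planeProj_single_sq {n : ℕ} (hn : 1 ≤ n) :
    ∑ i : Fin (n + 1), (planeProj n (EuclideanSpace.single i 1)) ^ 2 = 0 := by
  have hne : (0 : Fin (n + 1)) ≠ Fin.last n := by
    intro h
    have := congrArg Fin.val h
    simp at this
    omega
  have : ∀ i : Fin (n + 1), (planeProj n (EuclideanSpace.single i 1)) ^ 2 =
      (if i = 0 then 1 else 0) + (if i = Fin.last n then -1 else 0) := by
    intro i
    rw [planeProj_apply]
    by_cases h0 : i = 0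
    · subst h0
      simp [hne, hne.symm]
    · by_cases h1 : i = Fin.last n
      · subst h1
        simp [hne]
        omega
      · simp [h0, h1, Ne.symm h0, Ne.symm h1, eq_comm]
  simp_rw [this]
  simp [Finset.sum_add_distrib]

lemma isHarmonicOn_of_re {n : ℕ} (hn : 1 ≤ n) {g : ℂ → ℂ} {U : Set ℂ} (hU : IsOpen U)
    (hg : DifferentiableOn ℂ g U) {f : EuclideanSpace ℝ (Fin (n + 1)) → ℝ}
    (hf : ∀ x ∈ planeProj n ⁻¹' U, f x = (g (planeProj n x)).re) :
    IsHarmonicOn f (planeProj n ⁻¹' U) := by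
  obtain ⟨h1, h2⟩ := contDiffOn_and_fderiv_fderiv_re_comp hU hg (planeProj n)
    (hU.preimage (planeProj n).continuous) (fun x hx => hx) hf
  refine ⟨h1, fun x hx => ?_⟩
  simp_rw [h2 x hx]
  rw [← Complex.re_sum, ← Finset.mul_sum, sum_planeProj_single_sq hn]
  simp

/-- `m` is a finite measure on `[-1, 1]` whose Chebyshev moments are those of harmonic measure of
`ℂ \ [-1, 1]` with pole `z`. -/
structure HasChebMoments (z : ℂ) (m : Measure ℝ) : Prop where
  finite : IsFiniteMeasure m
  support : m (Icc (-1 : ℝ) 1)ᶜ = 0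
  moment : ∀ k : ℕ, ∫ t, (Polynomial.Chebyshev.T ℝ k).eval t ∂m = chebHarm k z

lemma integrable_of_support_Icc {m : Measure ℝ} [IsFiniteMeasure m]
    (hm : m (Icc (-1 : ℝ) 1)ᶜ = 0) {φ : ℝ → ℝ} (hφ : Continuous φ) : Integrable φ m := by
  have h1 : m.restrict (Icc (-1 : ℝ) 1) = m :=
    Measure.restrict_eq_self_of_ae_mem (mem_ae_iff.2 hm)
  rw [← h1]
  exact hφ.continuousOn.integrableOn_compact isCompact_Icc

lemma HasChebMoments.measureReal_univ {z : ℂ} {m : Measure ℝ} (h : HasChebMoments z m) :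
    m.real univ = 1 := by
  have := h.moment 0
  have h2 : chebHarm 0 z = 1 := by
    unfold chebHarm
    norm_num
  rw [h2] at this
  simpa using this

/-- The Chebyshev polynomials as a graded basis of `ℝ[X]`. -/
def chebSequence : Polynomial.Sequence ℝ where
  elems' i := Polynomial.Chebyshev.T ℝ i
  degree_eq' i := by rw [Polynomial.Chebyshev.degree_T]; simp

lemma exists_continuous_extension (p : Polynomial ℝ) : ∃ H : ℂ → ℝ, Continuous H ∧
    (∀ z m, HasChebMoments z m → ∫ t, p.eval t ∂m = H z) ∧
    ∀ t ∈ Icc (-1 : ℝ) 1, H t = p.eval t := by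
  have hp : p ∈ Submodule.span ℝ (Set.range chebSequence) := by
    rw [Polynomial.Sequence.span]
    · trivial
    · intro i
      exact isUnit_iff_ne_zero.2 (Polynomial.leadingCoeff_ne_zero.2 (chebSequence.ne_zero i))
  induction hp using Submodule.span_induction with
  | mem x h =>
    obtain ⟨k, rfl⟩ := h
    exact ⟨chebHarm k, continuous_chebHarm k, fun z m h => h.moment k,
      fun t ht => chebHarm_ofReal k ht⟩
  | zero => exact ⟨0, continuous_zero, by simp, by simp⟩
  | add x y _ _ hx hy =>
    obtain ⟨H1, c1, i1, e1⟩ := hx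
    obtain ⟨H2, c2, i2, e2⟩ := hy
    refine ⟨H1 + H2, c1.add c2, fun z m h => ?_, fun t ht => by simp [e1 t ht, e2 t ht]⟩
    have := h.finite
    simp only [Polynomial.eval_add]
    rw [integral_add (integrable_of_support_Icc h.support x.continuous)
      (integrable_of_support_Icc h.support y.continuous), i1 z m h, i2 z m h]
    rfl
  | smul a x _ hx =>
    obtain ⟨H1, c1, i1, e1⟩ := hx
    refine ⟨a • H1, c1.const_smul a, fun z m h => ?_, fun t ht => by simp [e1 t ht]⟩
    simp only [Polynomial.eval_smul, smul_eq_mul]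
    rw [integral_const_mul, i1 z m h]
    rfl

lemma HasChebMoments.abs_integral_sub_le {z : ℂ} {m : Measure ℝ} (h : HasChebMoments z m)
    {φ ψ : ℝ → ℝ} (hφ : Continuous φ) (hψ : Continuous ψ) {ε : ℝ}
    (hε : ∀ t ∈ Icc (-1 : ℝ) 1, |φ t - ψ t| ≤ ε) : |∫ t, φ t ∂m - ∫ t, ψ t ∂m| ≤ ε := by
  have := h.finite
  rw [← integral_sub (integrable_of_support_Icc h.support hφ)
    (integrable_of_support_Icc h.support hψ)]
  have h1 : ∀ᵐ t ∂m, ‖φ t - ψ t‖ ≤ ε := by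
    filter_upwards [mem_ae_iff.2 h.support] with t ht
    exact hε t ht
  have h2 := norm_integral_le_of_norm_le_const h1
  rw [h.measureReal_univ, mul_one] at h2
  exact h2

lemma HasChebMoments.ext {z : ℂ} {μ ν : Measure ℝ} (hμ : HasChebMoments z μ)
    (hν : HasChebMoments z ν) : μ = ν := by
  have := hμ.finite
  have := hν.finite
  apply ext_of_forall_integral_eq_of_IsFiniteMeasure
  intro f
  apply eq_of_forall_dist_le
  intro ε hε
  obtain ⟨p, hp⟩ := exists_polynomial_near_of_continuousOn (-1) 1 f f.continuous.continuousOn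
    (ε / 2) (by positivity)
  obtain ⟨H, -, hH, -⟩ := exists_continuous_extension p
  have h1 := hμ.abs_integral_sub_le p.continuous f.continuous (fun t ht => (hp t ht).le)
  have h2 := hν.abs_integral_sub_le p.continuous f.continuous (fun t ht => (hp t ht).le)
  rw [hH z _ hμ] at h1
  rw [hH z _ hν] at h2
  rw [Real.dist_eq]
  rw [abs_le] at *
  constructor <;> linarith [h1.1, h1.2, h2.1, h2.2]

lemma tendsto_integral_of_hasChebMoments {m : ℂ → Measure ℝ}
    (hm : ∀ z ∉ slit, HasChebMoments z (m z)) {φ : ℝ → ℝ} (hφ : Continuous φ) {t : ℝ}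
    (ht : t ∈ Icc (-1 : ℝ) 1) :
    Tendsto (fun z => ∫ s, φ s ∂(m z)) (nhdsWithin (t : ℂ) slitᶜ) (nhds (φ t)) := by
  rw [Metric.tendsto_nhds]
  intro ε hε
  obtain ⟨p, hp⟩ := exists_polynomial_near_of_continuousOn (-1) 1 φ hφ.continuousOn
    (ε / 3) (by positivity)
  obtain ⟨H, hc, hH, hv⟩ := exists_continuous_extension p
  have h1 : ∀ᶠ z in nhdsWithin (t : ℂ) slitᶜ, dist (H z) (H t) < ε / 3 :=
    (hc.continuousAt.mono_left nhdsWithin_le_nhds).eventually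
      (Metric.ball_mem_nhds _ (by positivity))
  filter_upwards [h1, self_mem_nhdsWithin] with z hz hzs
  have h2 := (hm z hzs).abs_integral_sub_le p.continuous hφ (fun t ht => (hp t ht).le)
  have h3 := hp t ht
  rw [hH z _ (hm z hzs)] at h2
  rw [hv t ht] at hz
  rw [Real.dist_eq] at *
  rw [abs_lt] at *
  rw [abs_le] at h2
  constructor <;> linarith [h2.1, h2.2, h3.1, h3.2, hz.1, hz.2]

lemma hasChebMoments_map {X : Type*} [MeasurableSpace X] {ω : Measure X} {P : X → ℂ}
    (hP : Measurable P) [IsFiniteMeasure ω] {z : ℂ} (hs : ω (P ⁻¹' slit)ᶜ = 0)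
    (hmom : ∀ k : ℕ, ∫ x, chebHarm k (P x) ∂ω = chebHarm k z) :
    HasChebMoments z (ω.map (fun x => (P x).re)) := by
  have hmeas : Measurable (fun x => (P x).re) := Complex.measurable_re.comp hP
  refine ⟨inferInstance, ?_, fun k => ?_⟩
  · rw [Measure.map_apply hmeas measurableSet_Icc.compl]
    refine measure_mono_null ?_ hs
    intro x hx hx2
    exact hx (mem_slit_iff.1 hx2).1
  · rw [integral_map hmeas.aemeasurable
      (Polynomial.continuous _).aestronglyMeasurable, ← hmom k]
    apply integral_congr_ae
    filter_upwards [mem_ae_iff.2 hs] with x hx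
    have hx2 := mem_slit_iff.1 hx
    have : P x = ((P x).re : ℂ) := by apply Complex.ext <;> simp [hx2.2]
    conv_rhs => rw [this]
    rw [chebHarm_ofReal k hx2.1]

lemma isBounded_range_of_abs_le {X : Type*} {f : X → ℝ} {C : ℝ} (h : ∀ x, |f x| ≤ C) :
    Bornology.IsBounded (Set.range f) := by
  rw [isBounded_iff_forall_norm_le]
  exact ⟨C, by rintro _ ⟨x, rfl⟩; exact h x⟩

lemma harmonicOnC_chebHarm (k : ℕ) : HarmonicOnC (chebHarm k) slitᶜ :=
  harmonicOnC_of_re isClosed_slit.isOpen_compl (differentiableOn_slitMap.pow k)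
    (fun _ hz => chebHarm_eq_re hz k)

lemma IsHarmonicMeasurePoleC.measure_compl_slit {z : ℂ} {ω : Measure ℂ}
    (h : IsHarmonicMeasurePoleC slitᶜ z ω) : ω slitᶜ = 0 := by
  refine measure_mono_null ?_ h.1
  rw [frontier_compl]
  exact compl_subset_compl.2 isClosed_slit.frontier_subset

lemma IsHarmonicMeasurePoleC.isFiniteMeasure {Ω : Set ℂ} {z : ℂ} {ω : Measure ℂ}
    (h : IsHarmonicMeasurePoleC Ω z ω) : IsFiniteMeasure ω :=
  ⟨h.2.1.trans_lt ENNReal.one_lt_top⟩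

lemma IsHarmonicMeasurePoleC.hasChebMoments {z : ℂ} {ω : Measure ℂ}
    (h : IsHarmonicMeasurePoleC slitᶜ z ω) : HasChebMoments z (ω.map Complex.re) := by
  have := h.isFiniteMeasure
  exact hasChebMoments_map (P := fun z => z) measurable_id h.measure_compl_slit (fun k =>
    (h.2.2 _ (continuous_chebHarm k) (isBounded_range_of_abs_le (abs_chebHarm_le k))
      (harmonicOnC_chebHarm k)).symm)

/-- Push-forward to `[-1, 1]` of the Poisson measure of the unit disc with pole `w`. -/
def poissonMeasure (w : ℂ) : Measure ℝ :=
  ((volume.restrict (uIoc 0 (2 * π))).withDensity (fun θ =>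
    ((Real.toNNReal ((2 * π)⁻¹ * poissonKernel 0 w (circleMap 0 1 θ)) : NNReal) :
      ℝ≥0∞))).map Real.cos

lemma continuous_poissonKernel_circleMap {w : ℂ} (hw : ‖w‖ < 1) :
    Continuous (fun θ : ℝ => poissonKernel 0 w (circleMap 0 1 θ)) := by
  simp only [poissonKernel_def]
  refine Continuous.div (by fun_prop) (by fun_prop) ?_
  intro θ h
  rw [sq_eq_zero_iff, norm_eq_zero, sub_zero, sub_zero, sub_eq_zero] at h
  rw [← h] at hw
  simp at hw

lemma poissonKernel_circleMap_nonneg {w : ℂ} (hw : ‖w‖ < 1) (θ : ℝ) :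
    0 ≤ poissonKernel 0 w (circleMap 0 1 θ) := by
  rw [poissonKernel_def]
  have : ‖w‖ ^ 2 ≤ 1 := pow_le_one₀ (norm_nonneg _) hw.le
  apply div_nonneg _ (by positivity)
  simpa using hw.le

lemma isFiniteMeasure_poissonMeasure {w : ℂ} (hw : ‖w‖ < 1) :
    IsFiniteMeasure (poissonMeasure w) := by
  have hc := continuous_poissonKernel_circleMap hw
  unfold poissonMeasure
  have h2 : IntegrableOn (fun θ => (2 * π)⁻¹ * poissonKernel 0 w (circleMap 0 1 θ))
      (uIoc 0 (2 * π)) :=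
    ((hc.const_mul _).integrableOn_Icc).mono_set (uIoc_subset_uIcc)
  have : IsFiniteMeasure ((volume.restrict (uIoc 0 (2 * π))).withDensity (fun θ =>
    ((Real.toNNReal ((2 * π)⁻¹ * poissonKernel 0 w (circleMap 0 1 θ)) : NNReal) : ℝ≥0∞))) :=
    isFiniteMeasure_withDensity_ofReal h2.2
  infer_instance

lemma integral_poissonMeasure {w : ℂ} (hw : ‖w‖ < 1) {φ : ℝ → ℝ} (hφ : Measurable φ) :
    ∫ t, φ t ∂(poissonMeasure w) =
      Real.circleAverage (fun ζ => poissonKernel 0 w ζ * φ ζ.re) 0 1 := by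
  have hc := continuous_poissonKernel_circleMap hw
  unfold poissonMeasure
  rw [integral_map Real.measurable_cos.aemeasurable hφ.aestronglyMeasurable,
    integral_withDensity_eq_integral_smul
      ((hc.measurable.const_mul _).real_toNNReal), Real.circleAverage_def,
    intervalIntegral.integral_of_le (by positivity), ← uIoc_of_le (by positivity), smul_eq_mul,
    ← integral_const_mul]
  congr 1
  ext θ
  have h1 : (circleMap 0 1 θ).re = Real.cos θ := by simp [circleMap, Complex.exp_ofReal_mul_I_re]
  rw [NNReal.smul_def, Real.coe_toNNReal _ (mul_nonneg (by positivity)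
    (poissonKernel_circleMap_nonneg hw θ)), h1]
  simp [mul_assoc]

lemma hasChebMoments_poissonMeasure {z : ℂ} (hz : z ∉ slit) :
    HasChebMoments z (poissonMeasure (slitMap z)) := by
  have hw := norm_slitMap_lt_one hz
  refine ⟨isFiniteMeasure_poissonMeasure hw, ?_, fun k => ?_⟩
  · unfold poissonMeasure
    rw [Measure.map_apply Real.measurable_cos measurableSet_Icc.compl,
      show Real.cos ⁻¹' (Icc (-1) 1)ᶜ = ∅ by ext θ; simp [Real.neg_one_le_cos, Real.cos_le_one],
      measure_empty]
  · rw [integral_poissonMeasure hw (Polynomial.continuous _).measurable, chebHarm_eq_re hz]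
    have hd : DiffContOnCl ℂ (fun ζ : ℂ => ζ ^ k) (ball 0 1) :=
      (differentiable_pow k).diffContOnCl
    have h1 := hd.circleAverage_poissonKernel_smul (w := slitMap z) (by simpa using hw)
    have hci : CircleIntegrable (poissonKernel 0 (slitMap z) • fun ζ : ℂ => ζ ^ k) 0 1 := by
      have hc := continuous_poissonKernel_circleMap hw
      apply Continuous.intervalIntegrable
      simp only [Pi.smul_apply']
      exact hc.smul ((continuous_circleMap 0 1).pow k)
    rw [← h1]
    have h2 := Complex.reCLM.circleAverage_comp_comm hci
    rw [Complex.reCLM_apply] at h2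
    rw [← h2]
    apply Real.circleAverage_congr_sphere
    intro ζ hζ
    have hζ1 : ‖ζ‖ = 1 := by simpa using hζ
    obtain ⟨θ, rfl⟩ : ∃ θ : ℝ, ζ = Complex.exp (θ * Complex.I) :=
      ⟨ζ.arg, by have h := Complex.norm_mul_exp_arg_mul_I ζ; rw [hζ1] at h; simpa using h.symm⟩
    simp only [Function.comp_apply, Pi.smul_apply', Complex.reCLM_apply, Complex.real_smul,
      Complex.re_ofReal_mul]
    rw [← Complex.exp_nat_mul, Complex.exp_ofReal_mul_I_re, Polynomial.Chebyshev.T_real_cos]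
    have : ((k : ℂ) * (θ * Complex.I)) = ((k * θ : ℝ) : ℂ) * Complex.I := by push_cast; ring
    rw [this, Complex.exp_ofReal_mul_I_re]
    simp

/-- A measure with the moments of harmonic measure gives an interval the mass
`Re G (slitMap z)` for a function `G` holomorphic in the disc, independent of `z`. -/
lemma exists_holomorphic_measureReal (a b : ℝ) : ∃ G : ℂ → ℂ, DifferentiableOn ℂ G (ball 0 1) ∧
    ∀ z ∉ slit, ∀ m, HasChebMoments z m → m.real (Icc a b) = (G (slitMap z)).re := by
  let φ : ℝ → ℝ := (Icc a b).indicator 1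
  have hφ : Measurable φ := measurable_one.indicator measurableSet_Icc
  let g : ℂ → ℝ := fun ζ => φ ζ.re
  have hgm : Measurable g := hφ.comp Complex.measurable_re
  have hgb : ∀ ζ, ‖g ζ‖ ≤ 1 := fun ζ => by
    simp only [g, φ, Set.indicator]
    split_ifs <;> simp
  have hci : CircleIntegrable g 0 1 := by
    rw [CircleIntegrable, intervalIntegrable_iff]
    exact Measure.integrableOn_of_bounded (M := 1)
      (by rw [Real.volume_uIoc]; exact ENNReal.ofReal_ne_top)
      (hgm.comp (continuous_circleMap 0 1).measurable).aestronglyMeasurable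
      (Filter.Eventually.of_forall fun θ => hgb _)
  have hci2 : CircleIntegrable (fun ζ => (g ζ : ℂ)) 0 1 := by
    simp only [CircleIntegrable, intervalIntegrable_iff] at hci ⊢
    exact Complex.ofRealCLM.integrable_comp hci
  refine ⟨_, differentiableOn_circleAverage_herglotzRieszKernel_smul hci2, fun z hz m hm => ?_⟩
  have hw := norm_slitMap_lt_one hz
  rw [re_circleAverage_herglotzRieszKernel_smul hci (by simpa using hw),
    ← poissonKernel_eq_re_herglotzRieszKernel]
  rw [hm.ext (hasChebMoments_poissonMeasure hz)]
  have h1 := integral_poissonMeasure hw hφ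
  rw [integral_indicator_one measurableSet_Icc] at h1
  rw [h1]
  rfl

lemma tendsto_measureReal_zero {m : ℂ → Measure ℝ} (hm : ∀ z ∉ slit, HasChebMoments z (m z))
    {a b t : ℝ} (ht : t ∈ Icc (-1 : ℝ) 1) (htab : t ∉ Icc a b) :
    Tendsto (fun z => (m z).real (Icc a b)) (nhdsWithin (t : ℂ) slitᶜ) (nhds 0) := by
  obtain ⟨φ, h0, h1, h01⟩ := exists_continuous_zero_one_of_isClosed (isClosed_singleton (x := t))
    (isClosed_Icc (a := a) (b := b)) (by simpa using htab)
  have hlim := tendsto_integral_of_hasChebMoments hm φ.continuous ht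
  rw [h0 rfl] at hlim
  refine tendsto_of_tendsto_of_tendsto_of_le_of_le' tendsto_const_nhds hlim
    (Eventually.of_forall fun z => measureReal_nonneg) ?_
  filter_upwards [self_mem_nhdsWithin] with z hz
  have := (hm z hz).finite
  rw [← integral_indicator_one measurableSet_Icc]
  apply integral_mono ((integrable_const 1).indicator measurableSet_Icc)
    (integrable_of_support_Icc (hm z hz).support φ.continuous)
  intro s
  by_cases hs : s ∈ Icc a b
  · simp [hs, h1 hs]
  · simp [hs, (h01 s).1]

lemma tendsto_measureReal_one {m : ℂ → Measure ℝ} (hm : ∀ z ∉ slit, HasChebMoments z (m z))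
    {a b t : ℝ} (ht : t ∈ Icc (-1 : ℝ) 1) (htab : t ∈ Ioo a b) :
    Tendsto (fun z => (m z).real (Icc a b)) (nhdsWithin (t : ℂ) slitᶜ) (nhds 1) := by
  obtain ⟨φ, h0, h1, h01⟩ := exists_continuous_zero_one_of_isClosed
    (isOpen_Ioo (a := a) (b := b)).isClosed_compl (isClosed_singleton (x := t))
    (by simpa using htab)
  have hlim := tendsto_integral_of_hasChebMoments hm φ.continuous ht
  rw [h1 rfl] at hlim
  refine tendsto_of_tendsto_of_tendsto_of_le_of_le' hlim tendsto_const_nhds ?_ ?_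
  · filter_upwards [self_mem_nhdsWithin] with z hz
    have := (hm z hz).finite
    rw [← integral_indicator_one measurableSet_Icc]
    apply integral_mono (integrable_of_support_Icc (hm z hz).support φ.continuous)
      ((integrable_const 1).indicator measurableSet_Icc)
    intro s
    by_cases hs : s ∈ Icc a b
    · simp [hs, (h01 s).2]
    · simp [hs, h0 (fun h => hs (Ioo_subset_Icc_self h))]
  · filter_upwards [self_mem_nhdsWithin] with z hz
    have := (hm z hz).finite
    rw [← (hm z hz).measureReal_univ]
    exact measureReal_mono (subset_univ _)

/-- The squared distance from `z` to the point `cos θ` of the slit. -/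
def slitDistSq (z : ℂ) (θ : ℝ) : ℝ := (z.re - Real.cos θ) ^ 2 + z.im ^ 2

lemma slitDistSq_nonneg (z : ℂ) (θ : ℝ) : 0 ≤ slitDistSq z θ := by
  unfold slitDistSq; positivity

lemma slitDistSq_eq_norm_sq (z : ℂ) (θ : ℝ) : slitDistSq z θ = ‖z - (Real.cos θ : ℂ)‖ ^ 2 := by
  rw [← Complex.normSq_eq_norm_sq, Complex.normSq_apply, slitDistSq, Complex.sub_re,
    Complex.sub_im, Complex.ofReal_re, Complex.ofReal_im]
  ring

lemma slitDistSq_le (z : ℂ) (θ : ℝ) : slitDistSq z θ ≤ (‖z‖ + 1) ^ 2 := by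
  rw [slitDistSq_eq_norm_sq]
  have h1 : ‖(Real.cos θ : ℂ)‖ ≤ 1 := by
    rw [Complex.norm_real]; exact Real.abs_cos_le_one θ
  have := norm_sub_le z (Real.cos θ : ℂ)
  gcongr
  linarith

lemma mul_sq_le_abs_cos_sub_cos {φ θ : ℝ} (hφ : φ ∈ Icc 0 π) (hθ : θ ∈ Icc 0 π) :
    2 * (|φ - θ| / π) ^ 2 ≤ |Real.cos φ - Real.cos θ| := by
  wlog h : θ ≤ φ generalizing φ θ
  · rw [abs_sub_comm, abs_sub_comm (Real.cos φ)]
    exact this hθ hφ (le_of_not_ge h)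
  have hpi := Real.pi_pos
  have h1 : (φ - θ) / π ≤ Real.sin ((φ - θ) / 2) := by
    have := Real.mul_le_sin (x := (φ - θ) / 2) (by linarith) (by linarith [hφ.2, hθ.1])
    calc (φ - θ) / π = 2 / π * ((φ - θ) / 2) := by field_simp
      _ ≤ _ := this
  have h2 : Real.sin ((φ - θ) / 2) ≤ Real.sin ((φ + θ) / 2) := by
    rcases le_total ((φ + θ) / 2) (π / 2) with h3 | h3
    · exact Real.sin_le_sin_of_le_of_le_pi_div_two (by linarith) h3 (by linarith [hθ.1])
    · rw [← Real.sin_pi_sub ((φ + θ) / 2)]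
      exact Real.sin_le_sin_of_le_of_le_pi_div_two (by linarith) (by linarith)
        (by linarith [hφ.2])
  have h0 : 0 ≤ (φ - θ) / π := div_nonneg (by linarith) hpi.le
  rw [abs_of_nonneg (by linarith : 0 ≤ φ - θ), Real.cos_sub_cos, abs_mul, abs_mul, abs_neg,
    abs_of_nonneg (h0.trans h1), abs_of_nonneg ((h0.trans h1).trans h2), abs_two]
  nlinarith [mul_le_mul h1 (h1.trans h2) h0 (h0.trans h1)]

lemma abs_cos_arccos_sub_cos_le (x θ : ℝ) :
    |Real.cos (Real.arccos x) - Real.cos θ| ≤ |x - Real.cos θ| := by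
  have h1 := Real.neg_one_le_cos θ
  have h2 := Real.cos_le_one θ
  rcases le_total x (-1) with h | h
  · rw [Real.arccos_of_le_neg_one h, Real.cos_pi, abs_of_nonpos (by linarith),
      abs_of_nonpos (by linarith)]
    linarith
  rcases le_total 1 x with h' | h'
  · rw [Real.arccos_of_one_le h', Real.cos_zero, abs_of_nonneg (by linarith),
      abs_of_nonneg (by linarith)]
    linarith
  rw [Real.cos_arccos h h']

lemma exp_neg_le_rpow {u : ℝ} (hu : 0 < u) : Real.exp (-u) ≤ u ^ (-(1 / 8) : ℝ) := by
  rw [Real.exp_neg, Real.rpow_neg hu.le]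
  apply inv_anti₀ (Real.rpow_pos_of_pos hu _)
  rcases le_total u 1 with h | h
  · exact (Real.rpow_le_one hu.le h (by norm_num)).trans (Real.one_le_exp hu.le)
  · calc u ^ (1 / 8 : ℝ) ≤ u ^ (1 : ℝ) := Real.rpow_le_rpow_of_exponent_le h (by norm_num)
      _ = u := Real.rpow_one u
      _ ≤ _ := by linarith [Real.add_one_le_exp u]

lemma exists_integral_exp_neg_slitDistSq_le : ∃ C : ℝ, 0 ≤ C ∧ ∀ lam : ℝ, 0 < lam → ∀ z : ℂ,
    ∫ θ in 0..π, Real.exp (-(lam * slitDistSq z θ)) ≤ C * lam ^ (-(1 / 8) : ℝ) := by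
  have hpi := Real.pi_pos
  have hintg : ∀ c d : ℝ, IntervalIntegrable (fun s : ℝ => |s| ^ (-(1 / 2) : ℝ)) volume c d := by
    intro c d
    have h1 : ∀ d : ℝ, 0 ≤ d →
        IntervalIntegrable (fun s : ℝ => |s| ^ (-(1 / 2) : ℝ)) volume 0 d := fun d hd => by
      apply (intervalIntegral.intervalIntegrable_rpow' (r := -(1/2)) (by norm_num)).congr
      intro s hs
      rw [uIoc_of_le hd] at hs
      simp only [abs_of_pos hs.1]
    have h2 : ∀ d : ℝ, IntervalIntegrable (fun s : ℝ => |s| ^ (-(1 / 2) : ℝ)) volume 0 d := by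
      intro d
      rcases le_total 0 d with h | h
      · exact h1 d h
      · rw [IntervalIntegrable.iff_comp_neg]
        simpa using h1 (-d) (by linarith)
    exact (h2 c).symm.trans (h2 d)
  set C0 := ∫ s in (-π)..π, |s| ^ (-(1 / 2) : ℝ) with hC0
  have hC0n : 0 ≤ C0 := intervalIntegral.integral_nonneg (by linarith) fun s _ => by positivity
  set k : ℝ := (4 / π ^ 4) ^ (-(1 / 8) : ℝ) with hk
  have hkn : 0 ≤ k := by positivity
  refine ⟨k * C0, by positivity, fun lam hl z => ?_⟩
  set φ := Real.arccos z.re with hφ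
  have hφm : φ ∈ Icc 0 π := ⟨Real.arccos_nonneg _, Real.arccos_le_pi _⟩
  have hcont : Continuous fun θ => Real.exp (-(lam * slitDistSq z θ)) := by
    have : Continuous fun θ => slitDistSq z θ := by unfold slitDistSq; fun_prop
    fun_prop
  have hbi : IntervalIntegrable (fun θ : ℝ => |φ - θ| ^ (-(1 / 2) : ℝ)) volume 0 π := by
    have := (hintg (φ - 0) (φ - π)).comp_sub_left φ
    simpa using this
  calc ∫ θ in 0..π, Real.exp (-(lam * slitDistSq z θ))
      ≤ ∫ θ in 0..π, (lam ^ (-(1 / 8) : ℝ) * k) * |φ - θ| ^ (-(1 / 2) : ℝ) := by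
        apply intervalIntegral.integral_mono_ae_restrict hpi.le
          (hcont.intervalIntegrable _ _) (hbi.const_mul _)
        have hne : ∀ᵐ θ : ℝ ∂(volume.restrict (Icc 0 π)), θ ≠ φ :=
          ae_restrict_of_ae (Measure.ae_ne volume φ)
        filter_upwards [hne, ae_restrict_mem measurableSet_Icc] with θ h1 h2
        have hpos : 0 < |φ - θ| := abs_pos.2 (sub_ne_zero.2 h1.symm)
        have h3 : 4 / π ^ 4 * |φ - θ| ^ 4 ≤ slitDistSq z θ := by
          have h4 := (mul_sq_le_abs_cos_sub_cos hφm h2).trans (abs_cos_arccos_sub_cos_le z.re θ)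
          calc 4 / π ^ 4 * |φ - θ| ^ 4 = (2 * (|φ - θ| / π) ^ 2) ^ 2 := by field_simp; ring
            _ ≤ |z.re - Real.cos θ| ^ 2 := by gcongr
            _ ≤ _ := by rw [sq_abs]; unfold slitDistSq; nlinarith [sq_nonneg z.im]
        have hA : 0 < lam * (4 / π ^ 4 * |φ - θ| ^ 4) := by positivity
        calc Real.exp (-(lam * slitDistSq z θ))
            ≤ Real.exp (-(lam * (4 / π ^ 4 * |φ - θ| ^ 4))) := by gcongr
          _ ≤ (lam * (4 / π ^ 4 * |φ - θ| ^ 4)) ^ (-(1 / 8) : ℝ) := exp_neg_le_rpow hA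
          _ = _ := by
            rw [Real.mul_rpow hl.le (by positivity), Real.mul_rpow (by positivity) (by positivity),
              ← Real.rpow_natCast |φ - θ|, ← Real.rpow_mul hpos.le, mul_assoc]
            norm_num [hk]
    _ = (lam ^ (-(1 / 8) : ℝ) * k) * ∫ s in (φ - π)..(φ - 0), |s| ^ (-(1 / 2) : ℝ) := by
        rw [intervalIntegral.integral_const_mul,
          intervalIntegral.integral_comp_sub_left (fun s => |s| ^ (-(1 / 2) : ℝ)) φ]
    _ ≤ (lam ^ (-(1 / 8) : ℝ) * k) * C0 := by
        gcongr
        exact intervalIntegral.integral_mono_interval (by linarith [hφm.1]) (by linarith)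
          (by linarith [hφm.2]) (Eventually.of_forall fun s => by positivity) (hintg _ _)
    _ = _ := by ring

/-- The planar Gaussian of inverse width `lam`, averaged over the slit against `cos (j θ) dθ`. -/
def slitGauss (j : ℕ) (lam : ℝ) (z : ℂ) : ℝ :=
  ∫ θ in 0..π, Real.cos (j * θ) * Real.exp (-(lam * slitDistSq z θ))

lemma continuous_slitGauss (j : ℕ) : Continuous fun p : ℝ × ℂ => slitGauss j p.1 p.2 := by
  unfold slitGauss
  apply intervalIntegral.continuous_parametric_intervalIntegral_of_continuous'
  unfold slitDistSq Function.uncurry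
  fun_prop

lemma continuous_slitDistSq_right (z : ℂ) : Continuous fun θ => slitDistSq z θ := by
  unfold slitDistSq; fun_prop

lemma abs_slitGauss_le_integral (j : ℕ) (lam : ℝ) (z : ℂ) :
    |slitGauss j lam z| ≤ ∫ θ in 0..π, Real.exp (-(lam * slitDistSq z θ)) := by
  have hc := continuous_slitDistSq_right z
  refine (intervalIntegral.abs_integral_le_integral_abs Real.pi_pos.le).trans ?_
  refine intervalIntegral.integral_mono_on Real.pi_pos.le ?_ ?_ fun θ _ => ?_
  · exact Continuous.intervalIntegrable (by fun_prop) _ _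
  · exact Continuous.intervalIntegrable (by fun_prop) _ _
  · rw [abs_mul, abs_of_pos (Real.exp_pos _)]
    exact mul_le_of_le_one_left (Real.exp_pos _).le (Real.abs_cos_le_one _)

lemma abs_slitGauss_le_pi (j : ℕ) {lam : ℝ} (hl : 0 ≤ lam) (z : ℂ) : |slitGauss j lam z| ≤ π := by
  have h := intervalIntegral.norm_integral_le_of_norm_le_const (a := 0) (b := π) (C := 1)
    (f := fun θ => Real.cos (j * θ) * Real.exp (-(lam * slitDistSq z θ))) fun θ _ => by
      rw [norm_mul, Real.norm_eq_abs, Real.norm_eq_abs, abs_of_pos (Real.exp_pos _)]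
      exact mul_le_one₀ (Real.abs_cos_le_one _) (Real.exp_pos _).le
        (Real.exp_le_one_iff.2 (by have := slitDistSq_nonneg z θ; nlinarith))
  simpa [slitGauss, abs_of_pos Real.pi_pos] using h

lemma slitGauss_zero_nonneg (lam : ℝ) (z : ℂ) : 0 ≤ slitGauss 0 lam z :=
  intervalIntegral.integral_nonneg Real.pi_pos.le fun θ _ => by
    simp [(Real.exp_pos _).le]

lemma integral_cos_nat_mul {j : ℕ} (hj : j ≠ 0) : ∫ θ in 0..π, Real.cos (j * θ) = 0 := by
  have hj' : (j : ℝ) ≠ 0 := by exact_mod_cast hj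
  rw [intervalIntegral.integral_comp_mul_left (fun t => Real.cos t) hj']
  simp [Real.sin_nat_mul_pi]

/-- The difference between `slitGauss` and its value with all distances equal to one. -/
def slitGaussDiff (j : ℕ) (lam : ℝ) (z : ℂ) : ℝ :=
  ∫ θ in 0..π, Real.cos (j * θ) * (Real.exp (-(lam * slitDistSq z θ)) - Real.exp (-lam))

lemma slitGaussDiff_eq (j : ℕ) (lam : ℝ) (z : ℂ) :
    slitGaussDiff j lam z =
      slitGauss j lam z - (∫ θ in 0..π, Real.cos (j * θ)) * Real.exp (-lam) := by
  have hc := continuous_slitDistSq_right z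
  unfold slitGaussDiff slitGauss
  simp only [mul_sub]
  rw [intervalIntegral.integral_sub (Continuous.intervalIntegrable (by fun_prop) _ _)
    (Continuous.intervalIntegrable (by fun_prop) _ _), intervalIntegral.integral_mul_const]

lemma slitGaussDiff_of_ne_zero {j : ℕ} (hj : j ≠ 0) (lam : ℝ) (z : ℂ) :
    slitGaussDiff j lam z = slitGauss j lam z := by
  rw [slitGaussDiff_eq, integral_cos_nat_mul hj]; ring

lemma slitGaussDiff_zero (lam : ℝ) (z : ℂ) :
    slitGaussDiff 0 lam z = slitGauss 0 lam z - π * Real.exp (-lam) := by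
  rw [slitGaussDiff_eq]; simp

lemma continuous_slitGaussDiff (j : ℕ) : Continuous fun p : ℝ × ℂ => slitGaussDiff j p.1 p.2 := by
  simp only [slitGaussDiff_eq]
  have := continuous_slitGauss j
  fun_prop

lemma abs_exp_neg_sub_exp_neg_le {u v : ℝ} (hu : 0 ≤ u) (hv : 0 ≤ v) :
    |Real.exp (-u) - Real.exp (-v)| ≤ |u - v| := by
  wlog h : u ≤ v generalizing u v
  · rw [abs_sub_comm, abs_sub_comm u]
    exact this hv hu (le_of_not_ge h)
  rw [abs_of_nonneg (sub_nonneg.2 (Real.exp_le_exp.2 (by linarith))), abs_of_nonpos (by linarith)]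
  have h1 : Real.exp (-v) = Real.exp (-u) * Real.exp (u - v) := by rw [← Real.exp_add]; ring_nf
  have h2 := Real.add_one_le_exp (u - v)
  have h3 : Real.exp (-u) ≤ 1 := Real.exp_le_one_iff.2 (by linarith)
  have h4 : 0 ≤ 1 - Real.exp (u - v) := sub_nonneg.2 (Real.exp_le_one_iff.2 (by linarith))
  rw [h1]
  nlinarith [Real.exp_pos (-u)]

lemma abs_slitGaussDiff_le (j : ℕ) {lam : ℝ} (hl : 0 ≤ lam) (z : ℂ) :
    |slitGaussDiff j lam z| ≤ lam * ((‖z‖ + 1) ^ 2 + 1) * π := by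
  have h := intervalIntegral.norm_integral_le_of_norm_le_const (a := 0) (b := π)
    (C := lam * ((‖z‖ + 1) ^ 2 + 1))
    (f := fun θ => Real.cos (j * θ) * (Real.exp (-(lam * slitDistSq z θ)) - Real.exp (-lam)))
    fun θ _ => by
      have h0 := slitDistSq_nonneg z θ
      rw [norm_mul, Real.norm_eq_abs, Real.norm_eq_abs]
      refine (mul_le_of_le_one_left (abs_nonneg _) (Real.abs_cos_le_one _)).trans ?_
      refine (abs_exp_neg_sub_exp_neg_le (by positivity) hl).trans ?_
      rw [show lam * slitDistSq z θ - lam = lam * (slitDistSq z θ - 1) by ring, abs_mul,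
        abs_of_nonneg hl]
      gcongr
      have h1 := slitDistSq_le z θ
      exact abs_le.2 ⟨by nlinarith, by linarith⟩
  simpa [slitGaussDiff, abs_of_pos Real.pi_pos] using h

/-- An integrable majorant on the half line. -/
def tailBound (lam : ℝ) : ℝ := if lam ≤ 1 then lam ^ (-(1 / 2) : ℝ) else lam ^ (-(9 / 8) : ℝ)

lemma integrableOn_tailBound : IntegrableOn tailBound (Ioi 0) := by
  rw [← Ioc_union_Ioi_eq_Ioi (zero_le_one : (0 : ℝ) ≤ 1)]
  refine IntegrableOn.union ?_ ?_
  · have h : IntegrableOn (fun x : ℝ => x ^ (-(1 / 2) : ℝ)) (Ioc 0 1) :=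
      (intervalIntegrable_iff_integrableOn_Ioc_of_le zero_le_one).1
        (intervalIntegral.intervalIntegrable_rpow' (by norm_num))
    exact h.congr_fun (fun x hx => by simp [tailBound, hx.2]) measurableSet_Ioc
  · have h : IntegrableOn (fun x : ℝ => x ^ (-(9 / 8) : ℝ)) (Ioi 1) :=
      integrableOn_Ioi_rpow_of_lt (by norm_num) zero_lt_one
    exact h.congr_fun (fun x hx => by simp [tailBound, not_le.2 (mem_Ioi.1 hx)]) measurableSet_Ioi

section GaussianSuperposition

variable {α : Type*} [MeasurableSpace α] {m : ℕ}

/-- The exponent of the anisotropic Gaussian with rates `c i a` and centre `t i a`. -/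
def gaussPhase (c t : Fin m → α → ℝ) (a : α) (x : EuclideanSpace ℝ (Fin m)) : ℝ :=
  ∑ i, c i a * (x i - t i a) ^ 2

/-- The superposition of anisotropic Gaussians with weight `p`. -/
def gaussIntegral (μ : Measure α) (c t : Fin m → α → ℝ) (p : α → ℝ)
    (x : EuclideanSpace ℝ (Fin m)) : ℝ :=
  ∫ a, p a * Real.exp (-gaussPhase c t a x) ∂μ

/-- `p` is integrable against every exponential `exp (-ε l)`. -/
def ExpIntegrable (μ : Measure α) (l p : α → ℝ) : Prop :=
  ∀ ε > 0, Integrable (fun a => p a * Real.exp (-(ε * l a))) μ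

lemma ExpIntegrable.mul {μ : Measure α} {l p g : α → ℝ} (hp : ExpIntegrable μ l p)
    (hg : Measurable g) (hgl : ∀ᵐ a ∂μ, |g a| ≤ l a) : ExpIntegrable μ l (fun a => g a * p a) := by
  intro ε hε
  have h1 := (hp (ε / 2) (by positivity)).norm.const_mul (2 / ε)
  have h3 := (hp ε hε).aestronglyMeasurable
  refine h1.mono' ?_ ?_
  · have := hg.aestronglyMeasurable.mul h3 (μ := μ)
    refine this.congr (Eventually.of_forall fun a => ?_)
    simp [mul_assoc]
  · filter_upwards [hgl] with a ha
    have h4 : l a ≤ 2 / ε * Real.exp (ε / 2 * l a) := by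
      have := Real.add_one_le_exp (ε / 2 * l a)
      rw [div_mul_eq_mul_div, le_div_iff₀ hε]
      linarith
    have h5 : Real.exp (-(ε * l a)) = Real.exp (-(ε / 2 * l a)) * Real.exp (-(ε / 2 * l a)) := by
      rw [← Real.exp_add]; ring_nf
    have h6 : Real.exp (ε / 2 * l a) * Real.exp (-(ε / 2 * l a)) = 1 := by
      rw [← Real.exp_add]; simp
    simp only [norm_mul, Real.norm_eq_abs, Real.abs_exp]
    calc |g a| * |p a| * Real.exp (-(ε * l a))
        ≤ 2 / ε * Real.exp (ε / 2 * l a) * |p a| * Real.exp (-(ε * l a)) := by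
          gcongr; exact ha.trans h4
      _ = 2 / ε * (|p a| * Real.exp (-(ε / 2 * l a))) := by
          rw [h5]
          linear_combination (2 / ε * |p a| * Real.exp (-(ε / 2 * l a))) * h6

/-- Rates bounded by `l` and centres in the unit cube. -/
structure IsGaussData (μ : Measure α) (l : α → ℝ) (c t : Fin m → α → ℝ) : Prop where
  measurable_rate : ∀ i, Measurable (c i)
  measurable_centre : ∀ i, Measurable (t i)
  abs_rate_le : ∀ᵐ a ∂μ, ∀ i, |c i a| ≤ l a
  abs_centre_le : ∀ᵐ a ∂μ, ∀ i, |t i a| ≤ 1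

variable {μ : Measure α} {l : α → ℝ} {c t : Fin m → α → ℝ}

lemma IsGaussData.measurable_gaussPhase (h : IsGaussData μ l c t)
    (x : EuclideanSpace ℝ (Fin m)) : Measurable fun a => gaussPhase c t a x := by
  unfold gaussPhase
  exact Finset.measurable_sum _ fun i _ =>
    (h.measurable_rate i).mul ((measurable_const.sub (h.measurable_centre i)).pow_const 2)

lemma IsGaussData.mul_rate (h : IsGaussData μ l c t) {p : α → ℝ} (hp : ExpIntegrable μ l p)
    (i : Fin m) : ExpIntegrable μ l (fun a => c i a * p a) :=
  hp.mul (h.measurable_rate i) (h.abs_rate_le.mono fun _ ha => ha i)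

lemma IsGaussData.mul_rate_centre (h : IsGaussData μ l c t) {p : α → ℝ}
    (hp : ExpIntegrable μ l p) (i : Fin m) : ExpIntegrable μ l (fun a => c i a * t i a * p a) := by
  refine hp.mul ((h.measurable_rate i).mul (h.measurable_centre i)) ?_
  filter_upwards [h.abs_rate_le, h.abs_centre_le] with a h1 h2
  rw [abs_mul]
  exact (mul_le_of_le_one_right (abs_nonneg _) (h2 i)).trans (h1 i)

/-- The phase dominates a multiple of `l` near `x₀`. -/
def PhaseCoercive (μ : Measure α) (l : α → ℝ) (c t : Fin m → α → ℝ)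
    (x₀ : EuclideanSpace ℝ (Fin m)) : Prop :=
  ∃ r > 0, ∃ ε > 0, ∀ᵐ a ∂μ, ∀ x ∈ ball x₀ r, ε * l a ≤ gaussPhase c t a x

lemma ExpIntegrable.aestronglyMeasurable {p : α → ℝ}
    (hl : Measurable l) (hp : ExpIntegrable μ l p) : AEStronglyMeasurable p μ := by
  have h1 := (hp 1 one_pos).aestronglyMeasurable
  have h2 : Measurable fun a => Real.exp (1 * l a) := by fun_prop
  refine (h1.mul h2.aestronglyMeasurable).congr (Eventually.of_forall fun a => ?_)
  simp [mul_assoc, ← Real.exp_add]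

lemma IsGaussData.integrable (h : IsGaussData μ l c t) (hl : Measurable l) {p : α → ℝ}
    (hp : ExpIntegrable μ l p) {x : EuclideanSpace ℝ (Fin m)} (hx : PhaseCoercive μ l c t x) :
    Integrable (fun a => p a * Real.exp (-gaussPhase c t a x)) μ := by
  obtain ⟨r, hr, ε, hε, hb⟩ := hx
  refine (hp ε hε).norm.mono' ((hp.aestronglyMeasurable hl).mul
    (Real.measurable_exp.comp (h.measurable_gaussPhase x).neg).aestronglyMeasurable) ?_
  filter_upwards [hb] with a ha
  simp only [norm_mul, Real.norm_eq_abs, Real.abs_exp]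
  have := ha x (mem_ball_self hr)
  gcongr

/-- The `i`-th coordinate functional. -/
abbrev coord (i : Fin m) : EuclideanSpace ℝ (Fin m) →L[ℝ] ℝ := EuclideanSpace.proj i

lemma norm_sum_smul_coord_le (s : Fin m → ℝ) : ‖∑ i, s i • coord i‖ ≤ ∑ i, |s i| := by
  refine ContinuousLinearMap.opNorm_le_bound _ (Finset.sum_nonneg fun i _ => abs_nonneg _)
    fun v => ?_
  simp only [_root_.sum_apply, _root_.smul_apply, EuclideanSpace.coe_proj,
    smul_eq_mul, Finset.sum_mul]
  refine norm_sum_le_of_le _ fun i _ => ?_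
  rw [norm_mul, Real.norm_eq_abs]
  gcongr
  exact PiLp.norm_apply_le v i

lemma IsGaussData.coord_integral (h : IsGaussData μ l c t) (hl : Measurable l) {p : α → ℝ}
    (hp : ExpIntegrable μ l p) {x : EuclideanSpace ℝ (Fin m)} (hx : PhaseCoercive μ l c t x)
    (i : Fin m) :
    Integrable (fun a => -2 * (x i * (c i a * p a * Real.exp (-gaussPhase c t a x)) -
      c i a * t i a * p a * Real.exp (-gaussPhase c t a x))) μ ∧
    ∫ a, -2 * (x i * (c i a * p a * Real.exp (-gaussPhase c t a x)) -
      c i a * t i a * p a * Real.exp (-gaussPhase c t a x)) ∂μ =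
      -2 * (x i * gaussIntegral μ c t (fun a => c i a * p a) x -
        gaussIntegral μ c t (fun a => c i a * t i a * p a) x) := by
  have h1 := h.integrable hl (h.mul_rate hp i) hx
  have h2 := h.integrable hl (h.mul_rate_centre hp i) hx
  refine ⟨((h1.const_mul (x i)).sub h2).const_mul (-2), ?_⟩
  rw [integral_const_mul, integral_sub (h1.const_mul _) h2, integral_const_mul]
  rfl

lemma hasFDerivAt_gaussPhase (c t : Fin m → α → ℝ) (a : α) (x : EuclideanSpace ℝ (Fin m)) :
    HasFDerivAt (gaussPhase c t a) (∑ i, (2 * c i a * (x i - t i a)) • coord i) x := by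
  unfold gaussPhase
  refine HasFDerivAt.fun_sum fun i _ => ?_
  have h1 : HasFDerivAt (fun y : EuclideanSpace ℝ (Fin m) => y i - t i a) (coord i) x :=
    ((coord i).hasFDerivAt (x := x)).sub_const (t i a)
  refine ((h1.pow 2).const_mul (c i a)).congr_fderiv ?_
  ext y
  simp
  ring

/-- The derivative of the weighted Gaussian `p a * exp (-gaussPhase c t a x)` in `x`. -/
def gaussDeriv (c t : Fin m → α → ℝ) (p : α → ℝ) (x : EuclideanSpace ℝ (Fin m)) (a : α) :
    EuclideanSpace ℝ (Fin m) →L[ℝ] ℝ :=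
  ∑ i, (-2 * (x i * (c i a * p a * Real.exp (-gaussPhase c t a x)) -
    c i a * t i a * p a * Real.exp (-gaussPhase c t a x))) • coord i

lemma hasFDerivAt_mul_exp_neg_gaussPhase (c t : Fin m → α → ℝ) (p : α → ℝ) (a : α)
    (x : EuclideanSpace ℝ (Fin m)) :
    HasFDerivAt (fun y => p a * Real.exp (-gaussPhase c t a y)) (gaussDeriv c t p x a) x := by
  refine ((hasFDerivAt_gaussPhase c t a x).neg.exp.const_mul (p a)).congr_fderiv ?_
  ext v
  simp only [gaussDeriv, _root_.sum_apply, _root_.smul_apply,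
    _root_.neg_apply, smul_eq_mul, Finset.mul_sum, ← Finset.sum_neg_distrib]
  exact Finset.sum_congr rfl fun i _ => by simp only [Pi.neg_apply]; ring

lemma norm_gaussDeriv_le (p : α → ℝ) {a : α} {x y : EuclideanSpace ℝ (Fin m)} {r ε : ℝ}
    (hy : y ∈ ball x r) (ht : ∀ i, |t i a| ≤ 1) (ha : ε * l a ≤ gaussPhase c t a y) :
    ‖gaussDeriv c t p y a‖ ≤
      ∑ i : Fin m, (2 * (‖x‖ + r + 1)) * ‖c i a * p a * Real.exp (-(ε * l a))‖ := by
  refine (norm_sum_smul_coord_le _).trans (Finset.sum_le_sum fun i _ => ?_)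
  have h2 : |y i - t i a| ≤ ‖x‖ + r + 1 := by
    have h3 : |y i| ≤ ‖y‖ := PiLp.norm_apply_le y i
    have h4 : ‖y‖ ≤ ‖x‖ + r := by
      have := norm_le_norm_add_norm_sub' y x
      rw [mem_ball, dist_eq_norm] at hy
      linarith
    have := abs_sub (y i) (t i a)
    linarith [ht i]
  rw [show -2 * (y i * (c i a * p a * Real.exp (-gaussPhase c t a y)) -
    c i a * t i a * p a * Real.exp (-gaussPhase c t a y)) =
    -(2 * (y i - t i a) * (c i a * p a * Real.exp (-gaussPhase c t a y))) by ring]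
  simp only [abs_neg, abs_mul, norm_mul, Real.norm_eq_abs, Real.abs_exp, abs_two]
  have h3 := (abs_nonneg _).trans h2
  gcongr

lemma IsGaussData.integral_gaussDeriv (h : IsGaussData μ l c t) (hl : Measurable l) {p : α → ℝ}
    (hp : ExpIntegrable μ l p) {x : EuclideanSpace ℝ (Fin m)} (hx : PhaseCoercive μ l c t x) :
    Integrable (gaussDeriv c t p x) μ ∧ ∫ a, gaussDeriv c t p x a ∂μ =
      ∑ i, (-2 * (x i * gaussIntegral μ c t (fun a => c i a * p a) x -
        gaussIntegral μ c t (fun a => c i a * t i a * p a) x)) • coord i := by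
  have hI := fun i => h.coord_integral hl hp hx i
  unfold gaussDeriv
  refine ⟨integrable_finsetSum _ fun i _ => (hI i).1.smul_const (coord i), ?_⟩
  rw [integral_finsetSum _ fun i _ => (hI i).1.smul_const (coord i)]
  exact Finset.sum_congr rfl fun i _ => by rw [integral_smul_const, (hI i).2]

lemma IsGaussData.hasFDerivAt (h : IsGaussData μ l c t) (hl : Measurable l) {p : α → ℝ}
    (hp : ExpIntegrable μ l p) {x : EuclideanSpace ℝ (Fin m)} (hx : PhaseCoercive μ l c t x) :
    HasFDerivAt (gaussIntegral μ c t p)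
      (∑ i, (-2 * (x i * gaussIntegral μ c t (fun a => c i a * p a) x -
        gaussIntegral μ c t (fun a => c i a * t i a * p a) x)) • coord i) x := by
  rw [← (h.integral_gaussDeriv hl hp hx).2]
  have hF'm := (h.integral_gaussDeriv hl hp hx).1.aestronglyMeasurable
  have hF := h.integrable hl hp hx
  obtain ⟨r, hr, ε, hε, hb⟩ := hx
  have hbd : Integrable (fun a => ∑ i : Fin m, (2 * (‖x‖ + r + 1)) *
      ‖c i a * p a * Real.exp (-(ε * l a))‖) μ :=
    integrable_finsetSum _ fun i _ => ((h.mul_rate hp i ε hε).norm).const_mul _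
  have hFm : ∀ᶠ y in nhds x, AEStronglyMeasurable
      (fun a => p a * Real.exp (-gaussPhase c t a y)) μ :=
    Eventually.of_forall fun y => (hp.aestronglyMeasurable hl).mul
      (Real.measurable_exp.comp (h.measurable_gaussPhase y).neg).aestronglyMeasurable
  have hF'b : ∀ᵐ a ∂μ, ∀ y ∈ ball x r, ‖gaussDeriv c t p y a‖ ≤
      ∑ i : Fin m, (2 * (‖x‖ + r + 1)) * ‖c i a * p a * Real.exp (-(ε * l a))‖ := by
    filter_upwards [hb, h.abs_centre_le] with a ha ht y hy
    exact norm_gaussDeriv_le p hy ht (ha y hy)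
  exact hasFDerivAt_integral_of_dominated_of_fderiv_le (ball_mem_nhds x hr) hFm hF hF'm hF'b hbd
    (Eventually.of_forall fun a y _ => hasFDerivAt_mul_exp_neg_gaussPhase c t p a y)

lemma IsGaussData.contDiffOn (h : IsGaussData μ l c t) (hl : Measurable l)
    {U : Set (EuclideanSpace ℝ (Fin m))} (hU : IsOpen U)
    (hx : ∀ x ∈ U, PhaseCoercive μ l c t x) (k : ℕ) {p : α → ℝ} (hp : ExpIntegrable μ l p) :
    ContDiffOn ℝ k (gaussIntegral μ c t p) U := by
  induction k generalizing p with
  | zero =>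
    exact contDiffOn_zero.2 fun x hxU =>
      (h.hasFDerivAt hl hp (hx x hxU)).continuousAt.continuousWithinAt
  | succ k ih =>
    push_cast
    rw [contDiffOn_succ_iff_fderiv_of_isOpen hU]
    refine ⟨fun x hxU => (h.hasFDerivAt hl hp (hx x hxU)).differentiableAt.differentiableWithinAt,
      by simp, ?_⟩
    refine ContDiffOn.congr ?_ fun x hxU => (h.hasFDerivAt hl hp (hx x hxU)).fderiv
    refine ContDiffOn.sum fun i _ => ?_
    have h1 : ContDiffOn ℝ k (fun y : EuclideanSpace ℝ (Fin m) => y i) U := by fun_prop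
    exact ContDiffOn.smul (contDiffOn_const.mul ((h1.mul (ih (h.mul_rate hp i))).sub
      (ih (h.mul_rate_centre hp i)))) contDiffOn_const

lemma IsGaussData.fderiv_apply_single (h : IsGaussData μ l c t) (hl : Measurable l)
    {p : α → ℝ} (hp : ExpIntegrable μ l p) {x : EuclideanSpace ℝ (Fin m)}
    (hx : PhaseCoercive μ l c t x) (i : Fin m) :
    fderiv ℝ (gaussIntegral μ c t p) x (EuclideanSpace.single i 1) =
      -2 * (x i * gaussIntegral μ c t (fun a => c i a * p a) x -
        gaussIntegral μ c t (fun a => c i a * t i a * p a) x) := by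
  rw [(h.hasFDerivAt hl hp hx).fderiv]
  simp

lemma IsGaussData.fderiv_fderiv (h : IsGaussData μ l c t) (hl : Measurable l)
    {U : Set (EuclideanSpace ℝ (Fin m))} (hU : IsOpen U)
    (hx : ∀ x ∈ U, PhaseCoercive μ l c t x) {p : α → ℝ} (hp : ExpIntegrable μ l p)
    {x : EuclideanSpace ℝ (Fin m)} (hxU : x ∈ U) (i : Fin m) :
    Integrable (fun a => (4 * (c i a * (x i - t i a)) ^ 2 - 2 * c i a) *
        (p a * Real.exp (-gaussPhase c t a x))) μ ∧
    fderiv ℝ (fun y => fderiv ℝ (gaussIntegral μ c t p) y (EuclideanSpace.single i 1)) x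
      (EuclideanSpace.single i 1) =
      ∫ a, (4 * (c i a * (x i - t i a)) ^ 2 - 2 * c i a) *
        (p a * Real.exp (-gaussPhase c t a x)) ∂μ := by
  have hxx := hx x hxU
  have heq : (fun y => fderiv ℝ (gaussIntegral μ c t p) y (EuclideanSpace.single i 1)) =ᶠ[nhds x]
      fun y => -2 * (y i * gaussIntegral μ c t (fun a => c i a * p a) y -
        gaussIntegral μ c t (fun a => c i a * t i a * p a) y) := by
    filter_upwards [hU.mem_nhds hxU] with y hy
    exact h.fderiv_apply_single hl hp (hx y hy) i
  have hp1 := h.mul_rate hp i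
  have hp2 := h.mul_rate_centre hp i
  have d1 := h.hasFDerivAt hl hp1 hxx
  have d2 := h.hasFDerivAt hl hp2 hxx
  have d0 : HasFDerivAt (fun y : EuclideanSpace ℝ (Fin m) => y i) (coord i) x :=
    (coord i).hasFDerivAt
  have i1 := h.integrable hl hp1 hxx
  have e1 := h.coord_integral hl hp1 hxx i
  have e2 := h.coord_integral hl hp2 hxx i
  have hd : fderiv ℝ (fun y => fderiv ℝ (gaussIntegral μ c t p) y (EuclideanSpace.single i 1)) x
      (EuclideanSpace.single i 1) =
      -2 * (gaussIntegral μ c t (fun a => c i a * p a) x + x i *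
        (-2 * (x i * gaussIntegral μ c t (fun a => c i a * (c i a * p a)) x -
          gaussIntegral μ c t (fun a => c i a * t i a * (c i a * p a)) x)) -
        (-2 * (x i * gaussIntegral μ c t (fun a => c i a * (c i a * t i a * p a)) x -
          gaussIntegral μ c t (fun a => c i a * t i a * (c i a * t i a * p a)) x))) := by
    rw [heq.fderiv_eq, (((d0.fun_mul d1).fun_sub d2).const_mul (-2)).fderiv]
    simp [_root_.sum_apply]
    ring
  let g : α → ℝ := fun a => -2 * (c i a * p a * Real.exp (-gaussPhase c t a x) + x i *
        (-2 * (x i * (c i a * (c i a * p a) * Real.exp (-gaussPhase c t a x)) -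
          c i a * t i a * (c i a * p a) * Real.exp (-gaussPhase c t a x))) -
        (-2 * (x i * (c i a * (c i a * t i a * p a) * Real.exp (-gaussPhase c t a x)) -
          c i a * t i a * (c i a * t i a * p a) * Real.exp (-gaussPhase c t a x))))
  have hg : (fun a => (4 * (c i a * (x i - t i a)) ^ 2 - 2 * c i a) *
        (p a * Real.exp (-gaussPhase c t a x))) = g := by
    ext a; simp only [g]; ring
  have e3 : Integrable (fun a => c i a * p a * Real.exp (-gaussPhase c t a x) + x i *
      (-2 * (x i * (c i a * (c i a * p a) * Real.exp (-gaussPhase c t a x)) -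
        c i a * t i a * (c i a * p a) * Real.exp (-gaussPhase c t a x)))) μ :=
    i1.add (e1.1.const_mul (x i))
  rw [hg, hd]
  refine ⟨(e3.sub e2.1).const_mul (-2), ?_⟩
  simp only [g]
  rw [integral_const_mul, integral_sub e3 e2.1, integral_add i1 (e1.1.const_mul (x i)),
    integral_const_mul, e1.2, e2.2]
  rfl

/-- A superposition of Gaussians is harmonic as soon as its formal Laplacian vanishes. -/
lemma IsGaussData.isHarmonicOn (h : IsGaussData μ l c t) (hl : Measurable l)
    {U : Set (EuclideanSpace ℝ (Fin m))} (hU : IsOpen U)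
    (hx : ∀ x ∈ U, PhaseCoercive μ l c t x) {p : α → ℝ} (hp : ExpIntegrable μ l p)
    (hlap : ∀ x ∈ U, Integrable (fun a => (∑ i, (4 * (c i a * (x i - t i a)) ^ 2 - 2 * c i a)) *
        (p a * Real.exp (-gaussPhase c t a x))) μ →
      ∫ a, (∑ i, (4 * (c i a * (x i - t i a)) ^ 2 - 2 * c i a)) *
        (p a * Real.exp (-gaussPhase c t a x)) ∂μ = 0) :
    IsHarmonicOn (gaussIntegral μ c t p) U := by
  refine ⟨h.contDiffOn hl hU hx 2 hp, fun x hxU => ?_⟩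
  have h1 := h.fderiv_fderiv hl hU hx hp hxU
  rw [Finset.sum_congr rfl fun i _ => (h1 i).2, ← integral_finsetSum _ fun i _ => (h1 i).1]
  simp only [← Finset.sum_mul]
  refine hlap x hxU ?_
  simpa only [← Finset.sum_mul] using integrable_finsetSum Finset.univ fun i _ => (h1 i).1

end GaussianSuperposition

/-- The Gaussian rate in the middle variables. -/
def midRate (b lam : ℝ) : ℝ := lam / (1 + b * lam)

/-- The Gaussian weight making the superposition harmonic. -/
def midWeight (k : ℕ) (b lam : ℝ) : ℝ := lam⁻¹ * √(b * midRate b lam) ^ k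

lemma measurable_midRate (b : ℝ) : Measurable (midRate b) := by
  unfold midRate; fun_prop

lemma measurable_midWeight (k : ℕ) (b : ℝ) : Measurable (midWeight k b) := by
  unfold midWeight
  have := measurable_midRate b
  fun_prop

lemma midRate_pos {b lam : ℝ} (hb : 0 < b) (hl : 0 < lam) : 0 < midRate b lam := by
  unfold midRate; positivity

lemma midRate_le {b lam : ℝ} (hb : 0 < b) (hl : 0 < lam) : midRate b lam ≤ lam := by
  unfold midRate
  exact div_le_self hl.le (by nlinarith [mul_pos hb hl])

lemma mul_midRate_le_one {b lam : ℝ} (hb : 0 < b) (hl : 0 < lam) : b * midRate b lam ≤ 1 := by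
  unfold midRate
  rw [← mul_div_assoc]
  exact (div_le_one (by positivity)).2 (by linarith)

lemma sqrt_mul_midRate_le_one {b lam : ℝ} (hb : 0 < b) (hl : 0 < lam) :
    √(b * midRate b lam) ≤ 1 :=
  Real.sqrt_le_iff.2 ⟨zero_le_one, by simpa using mul_midRate_le_one hb hl⟩

lemma midWeight_nonneg (k : ℕ) (b : ℝ) {lam : ℝ} (hl : 0 < lam) : 0 ≤ midWeight k b lam := by
  unfold midWeight; positivity

lemma midWeight_le_inv (k : ℕ) {b lam : ℝ} (hb : 0 < b) (hl : 0 < lam) :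
    midWeight k b lam ≤ lam⁻¹ := by
  unfold midWeight
  refine mul_le_of_le_one_right (by positivity) (pow_le_one₀ (by positivity) ?_)
  exact sqrt_mul_midRate_le_one hb hl

lemma midWeight_le_rpow {k : ℕ} (hk : k ≠ 0) {b lam : ℝ} (hb : 0 < b) (hl : 0 < lam) :
    midWeight k b lam ≤ √b * lam ^ (-(1 / 2) : ℝ) := by
  have h1 : √(b * midRate b lam) ≤ 1 := sqrt_mul_midRate_le_one hb hl
  have h2 : √(b * midRate b lam) ^ k ≤ √b * √lam := by
    refine (pow_le_of_le_one (by positivity) h1 hk).trans ?_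
    rw [← Real.sqrt_mul hb.le]
    exact Real.sqrt_le_sqrt (by gcongr; exact midRate_le hb hl)
  unfold midWeight
  calc lam⁻¹ * √(b * midRate b lam) ^ k ≤ lam⁻¹ * (√b * √lam) := by gcongr
    _ = √b * lam ^ (-(1 / 2) : ℝ) := by
      rw [Real.sqrt_eq_rpow lam, ← Real.rpow_neg_one, mul_left_comm, ← Real.rpow_add hl]
      norm_num

/-- The indices of the middle coordinates. -/
def midIdx {k : ℕ} (i : Fin k) : Fin (k + 2) := i.castSucc.succ

lemma midIdx_ne {k : ℕ} (i : Fin k) : ¬(midIdx i = 0 ∨ midIdx i = Fin.last (k + 1)) := by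
  rintro (h | h)
  · exact Fin.succ_ne_zero _ h
  · exact (Fin.castSucc_lt_last i.succ).ne (by rw [← h, midIdx, Fin.succ_castSucc])

lemma sum_univ_midIdx {k : ℕ} (g : Fin (k + 2) → ℝ) :
    ∑ i, g i = g 0 + g (Fin.last (k + 1)) + ∑ i : Fin k, g (midIdx i) := by
  rw [Fin.sum_univ_succ, Fin.sum_univ_castSucc, Fin.succ_last]
  simp only [midIdx]
  ring

/-- The square norm of the middle coordinates. -/
def midNormSq {k : ℕ} (x : EuclideanSpace ℝ (Fin (k + 2))) : ℝ := ∑ i : Fin k, x (midIdx i) ^ 2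

lemma midNormSq_nonneg {k : ℕ} (x : EuclideanSpace ℝ (Fin (k + 2))) : 0 ≤ midNormSq x :=
  Finset.sum_nonneg fun _ _ => sq_nonneg _

lemma continuous_midNormSq {k : ℕ} :
    Continuous (midNormSq : EuclideanSpace ℝ (Fin (k + 2)) → ℝ) := by
  unfold midNormSq; fun_prop

/-- The potential of a density on the strip that is Gaussian in the middle variables. -/
def stripPotential (k : ℕ) (b : ℝ) (j : ℕ) (x : EuclideanSpace ℝ (Fin (k + 2))) : ℝ :=
  ∫ lam in Ioi 0, midWeight k b lam *
    (Real.exp (-(midRate b lam * midNormSq x)) * slitGauss j lam (planeProj (k + 1) x))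

section Harmonic

/-- The Gaussian rates of the potential. -/
def stripRate (k : ℕ) (b : ℝ) (i : Fin (k + 2)) (a : ℝ × ℝ) : ℝ :=
  if i = 0 ∨ i = Fin.last (k + 1) then a.1 else midRate b a.1

/-- The Gaussian centres of the potential. -/
def stripCentre (k : ℕ) (i : Fin (k + 2)) (a : ℝ × ℝ) : ℝ :=
  if i = 0 then Real.cos a.2 else 0

/-- The parameter space of the Gaussians. -/
def stripMeasure : Measure (ℝ × ℝ) :=
  (volume.restrict (Ioi 0)).prod (volume.restrict (Ioc 0 π))

lemma ae_stripMeasure : ∀ᵐ a ∂stripMeasure, 0 < a.1 := by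
  have : ∀ᵐ l : ℝ ∂(volume.restrict (Ioi 0)), 0 < l := ae_restrict_mem measurableSet_Ioi
  exact Measure.quasiMeasurePreserving_fst.ae this

lemma gaussPhase_strip (k : ℕ) (b : ℝ) (a : ℝ × ℝ) (x : EuclideanSpace ℝ (Fin (k + 2))) :
    gaussPhase (stripRate k b) (stripCentre k) a x =
      a.1 * slitDistSq (planeProj (k + 1) x) a.2 + midRate b a.1 * midNormSq x := by
  rw [gaussPhase, sum_univ_midIdx]
  have h0 : Fin.last (k + 1) ≠ 0 := (Fin.last_pos).ne'
  have h1 : ∀ i : Fin k, midIdx i ≠ 0 := fun i h => midIdx_ne i (Or.inl h)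
  have h2 : ∀ i : Fin k, midIdx i ≠ Fin.last (k + 1) := fun i h => midIdx_ne i (Or.inr h)
  simp only [stripRate, stripCentre, h0, h1, h2, or_self, if_false, true_or, or_true,
    if_true, sub_zero, slitDistSq, planeProj_re, planeProj_im, midNormSq, Finset.mul_sum]
  ring

lemma laplacian_symbol_strip (k : ℕ) (b : ℝ) (a : ℝ × ℝ) (x : EuclideanSpace ℝ (Fin (k + 2))) :
    ∑ i, (4 * (stripRate k b i a * (x i - stripCentre k i a)) ^ 2 - 2 * stripRate k b i a) =
      4 * a.1 ^ 2 * slitDistSq (planeProj (k + 1) x) a.2 + 4 * midRate b a.1 ^ 2 * midNormSq x -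
        4 * a.1 - 2 * k * midRate b a.1 := by
  rw [sum_univ_midIdx]
  have h0 : Fin.last (k + 1) ≠ 0 := (Fin.last_pos).ne'
  have h1 : ∀ i : Fin k, midIdx i ≠ 0 := fun i h => midIdx_ne i (Or.inl h)
  have h2 : ∀ i : Fin k, midIdx i ≠ Fin.last (k + 1) := fun i h => midIdx_ne i (Or.inr h)
  simp only [stripRate, stripCentre, h0, h1, h2, or_self, if_false, true_or, or_true,
    if_true, sub_zero, slitDistSq, planeProj_re, planeProj_im, midNormSq, Finset.mul_sum,
    Finset.sum_sub_distrib, mul_pow, Finset.sum_const, Finset.card_univ, Fintype.card_fin,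
    nsmul_eq_mul, mul_assoc]
  ring

lemma isGaussData_strip (k : ℕ) {b : ℝ} (hb : 0 < b) :
    IsGaussData stripMeasure Prod.fst (stripRate k b) (stripCentre k) where
  measurable_rate i := by
    unfold stripRate
    split_ifs
    · exact measurable_fst
    · exact (measurable_midRate b).comp measurable_fst
  measurable_centre i := by
    unfold stripCentre
    split_ifs
    · exact Real.measurable_cos.comp measurable_snd
    · exact measurable_const
  abs_rate_le := by
    filter_upwards [ae_stripMeasure] with a ha i
    unfold stripRate
    split_ifs
    · exact (abs_of_pos ha).le
    · rw [abs_of_pos (midRate_pos hb ha)]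
      exact midRate_le hb ha
  abs_centre_le := by
    refine Eventually.of_forall fun a i => ?_
    unfold stripCentre
    split_ifs
    · exact Real.abs_cos_le_one _
    · simp

/-- The weight of the potential in parameter space. -/
def stripWeight (k : ℕ) (b : ℝ) (j : ℕ) (a : ℝ × ℝ) : ℝ :=
  midWeight k b a.1 * Real.cos (j * a.2)

lemma expIntegrable_stripWeight {k : ℕ} (hk : k ≠ 0) {b : ℝ} (hb : 0 < b) (j : ℕ) :
    ExpIntegrable stripMeasure Prod.fst (stripWeight k b j) := by
  intro ε hε
  have h1 : Integrable (fun lam : ℝ => √b * (lam ^ (-(1 / 2) : ℝ) * Real.exp (-(ε * lam))))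
      (volume.restrict (Ioi 0)) := by
    have := integrableOn_rpow_mul_exp_neg_mul_rpow (s := -(1 / 2)) (p := 1) (b := ε)
      (by norm_num) one_pos hε
    simp only [Real.rpow_one, neg_mul] at this
    exact Integrable.const_mul this _
  have h2 : Integrable (fun _ : ℝ => (1 : ℝ)) (volume.restrict (Ioc 0 π)) := by
    rw [integrable_const_iff]
    right
    exact isFiniteMeasure_restrict_Ioc 0 π
  refine (h1.mul_prod h2).mono' ?_ ?_
  · have : Measurable fun a : ℝ × ℝ => midWeight k b a.1 :=
      (measurable_midWeight k b).comp measurable_fst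
    have h3 : Measurable fun a : ℝ × ℝ => Real.cos (j * a.2) := by fun_prop
    have h4 : Measurable fun a : ℝ × ℝ => Real.exp (-(ε * a.1)) := by fun_prop
    exact ((this.mul h3).mul h4).aestronglyMeasurable
  · filter_upwards [ae_stripMeasure] with a ha
    simp only [stripWeight, norm_mul, Real.norm_eq_abs, Real.abs_exp,
      abs_of_nonneg (midWeight_nonneg k b ha), mul_one]
    calc midWeight k b a.1 * |Real.cos (j * a.2)| * Real.exp (-(ε * a.1))
        ≤ √b * a.1 ^ (-(1 / 2) : ℝ) * 1 * Real.exp (-(ε * a.1)) := by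
          gcongr
          · exact midWeight_le_rpow hk hb ha
          · exact Real.abs_cos_le_one _
      _ = _ := by ring

lemma phaseCoercive_strip (k : ℕ) {b : ℝ} (hb : 0 < b) {x : EuclideanSpace ℝ (Fin (k + 2))}
    (hx : planeProj (k + 1) x ∉ slit) :
    PhaseCoercive stripMeasure Prod.fst (stripRate k b) (stripCentre k) x := by
  have hne : slit.Nonempty := ⟨_, cos_mem_slit 0⟩
  have hd : 0 < infDist (planeProj (k + 1) x) slit :=
    (isClosed_slit.notMem_iff_infDist_pos hne).1 hx
  set δ := infDist (planeProj (k + 1) x) slit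
  have hc : Continuous fun y => infDist (planeProj (k + 1) y) slit :=
    (continuous_infDist_pt slit).comp (planeProj (k + 1)).continuous
  obtain ⟨r, hr, hball⟩ := Metric.isOpen_iff.1 (isOpen_Ioi.preimage hc (t := Ioi (δ / 2))) x
    (by simp only [mem_preimage, mem_Ioi]; linarith)
  refine ⟨r, hr, (δ / 2) ^ 2, by positivity, ?_⟩
  filter_upwards [ae_stripMeasure] with a ha y hy
  have h1 : δ / 2 < infDist (planeProj (k + 1) y) slit := hball hy
  have h2 := infDist_le_dist_of_mem (x := planeProj (k + 1) y) (cos_mem_slit a.2)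
  rw [dist_eq_norm] at h2
  rw [gaussPhase_strip, slitDistSq_eq_norm_sq]
  have h3 : 0 ≤ midRate b a.1 * midNormSq y :=
    mul_nonneg (midRate_pos hb ha).le (midNormSq_nonneg y)
  have h4 : (δ / 2) ^ 2 ≤ ‖planeProj (k + 1) y - (Real.cos a.2 : ℂ)‖ ^ 2 := by
    gcongr
    linarith
  nlinarith

lemma hasDerivAt_midRate {b lam : ℝ} (hb : 0 < b) (hl : 0 < lam) :
    HasDerivAt (midRate b) (1 / (1 + b * lam) ^ 2) lam := by
  have h1 : HasDerivAt (fun l : ℝ => 1 + b * l) b lam := by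
    simpa using ((hasDerivAt_id lam).const_mul b).const_add 1
  have h2 : 1 + b * lam ≠ 0 := by positivity
  refine ((hasDerivAt_id lam).div h1 h2).congr_deriv ?_
  simp only [id]
  ring

lemma hasDerivAt_mul_sqrt_midRate_pow (k : ℕ) {b lam : ℝ} (hb : 0 < b) (hl : 0 < lam) :
    HasDerivAt (fun l => l * √(b * midRate b l) ^ k)
      (√(b * midRate b lam) ^ k * (1 + k / 2 * (midRate b lam / lam))) lam := by
  have hβ := midRate_pos hb hl
  have hS : 0 < √(b * midRate b lam) := Real.sqrt_pos.2 (by positivity)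
  have hS2 : √(b * midRate b lam) ^ 2 = b * midRate b lam := Real.sq_sqrt (by positivity)
  have h1 := (((hasDerivAt_midRate hb hl).const_mul b).sqrt (by positivity)).fun_pow k
  refine ((hasDerivAt_id lam).mul h1).congr_deriv ?_
  have h3 : 1 + b * lam ≠ 0 := by positivity
  have h4 : midRate b lam / lam = 1 / (1 + b * lam) := by unfold midRate; field_simp
  rcases Nat.eq_zero_or_pos k with rfl | hk
  · simp
  obtain ⟨k, rfl⟩ := Nat.exists_eq_succ_of_ne_zero hk.ne'
  have h5 : lam * (b * (1 / (1 + b * lam) ^ 2)) = √(b * midRate b lam) ^ 2 / (1 + b * lam) := by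
    rw [hS2, midRate]; field_simp
  have h6 : lam * (b * (1 / (1 + b * lam) ^ 2) / (2 * √(b * midRate b lam))) =
      √(b * midRate b lam) / (1 + b * lam) / 2 := by
    rw [← mul_div_assoc, h5]; field_simp
  simp only [Nat.succ_eq_add_one, Nat.add_sub_cancel, id, one_mul, h4]
  push_cast
  calc _ = √(b * midRate b lam) ^ (k + 1) + (k + 1) * √(b * midRate b lam) ^ k *
        (lam * (b * (1 / (1 + b * lam) ^ 2) / (2 * √(b * midRate b lam)))) := by ring
    _ = _ := by rw [h6]; ring

lemma integral_laplacian_strip (k : ℕ) {b : ℝ} (hb : 0 < b) {r : ℝ} (hr : 0 < r) {q : ℝ}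
    (hq : 0 ≤ q) (C : ℝ)
    (hintg : IntegrableOn (fun lam => (4 * lam ^ 2 * r + 4 * midRate b lam ^ 2 * q - 4 * lam -
      2 * k * midRate b lam) * (midWeight k b lam * C *
        Real.exp (-(lam * r + midRate b lam * q)))) (Ioi 0)) :
    ∫ lam in Ioi 0, (4 * lam ^ 2 * r + 4 * midRate b lam ^ 2 * q - 4 * lam -
      2 * k * midRate b lam) * (midWeight k b lam * C *
        Real.exp (-(lam * r + midRate b lam * q))) = 0 := by
  let H : ℝ → ℝ := fun lam => (-4 * C) * (lam * √(b * midRate b lam) ^ k *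
    Real.exp (-(lam * r + midRate b lam * q)))
  have hS : ∀ lam, 0 < lam → √(b * midRate b lam) ^ k ≤ 1 := fun lam hl =>
    pow_le_one₀ (by positivity) (sqrt_mul_midRate_le_one hb hl)
  have hderiv : ∀ lam ∈ Ioi (0 : ℝ), HasDerivAt H ((4 * lam ^ 2 * r + 4 * midRate b lam ^ 2 * q -
      4 * lam - 2 * k * midRate b lam) * (midWeight k b lam * C *
        Real.exp (-(lam * r + midRate b lam * q)))) lam := by
    intro lam hl
    have hl : 0 < lam := hl
    have h1 := hasDerivAt_mul_sqrt_midRate_pow k hb hl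
    have h2 := ((((hasDerivAt_id lam).mul_const r).fun_add
      ((hasDerivAt_midRate hb hl).mul_const q)).fun_neg).exp
    refine ((h1.fun_mul h2).const_mul (-4 * C)).congr_deriv ?_
    have h3 : 1 + b * lam ≠ 0 := by positivity
    have h4 : 1 / (1 + b * lam) ^ 2 = (midRate b lam / lam) ^ 2 := by unfold midRate; field_simp
    simp only [midWeight, id, h4]
    field_simp
    ring
  have hcont : ContinuousWithinAt H (Ici 0) 0 := by
    have h1 : ContinuousAt (midRate b) 0 := by
      unfold midRate
      exact ContinuousAt.div (by fun_prop) (by fun_prop) (by simp)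
    exact ContinuousAt.continuousWithinAt (by fun_prop)
  have htop : Tendsto H atTop (nhds 0) := by
    have h1 : Tendsto (fun lam : ℝ => r⁻¹ * ((lam * r) ^ 1 * Real.exp (-(lam * r)))) atTop
        (nhds (r⁻¹ * 0)) :=
      ((Real.tendsto_pow_mul_exp_neg_atTop_nhds_zero 1).comp
        (tendsto_id.atTop_mul_const hr)).const_mul _
    have h2 : Tendsto (fun lam => lam * √(b * midRate b lam) ^ k *
        Real.exp (-(lam * r + midRate b lam * q))) atTop (nhds 0) := by
      rw [mul_zero] at h1
      refine squeeze_zero' ?_ ?_ h1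
      · filter_upwards [eventually_gt_atTop 0] with lam hl
        positivity
      · filter_upwards [eventually_gt_atTop 0] with lam hl
        have h3 : 0 ≤ midRate b lam * q := mul_nonneg (midRate_pos hb hl).le hq
        calc lam * √(b * midRate b lam) ^ k * Real.exp (-(lam * r + midRate b lam * q))
            ≤ lam * 1 * Real.exp (-(lam * r)) := by
              gcongr
              · exact hS lam hl
              · linarith
          _ = _ := by field_simp
    have h3 := h2.const_mul (-4 * C)
    rwa [mul_zero] at h3
  rw [integral_Ioi_of_hasDerivAt_of_tendsto hcont hderiv hintg htop]
  simp [H]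

lemma slitDistSq_pos {z : ℂ} (hz : z ∉ slit) (θ : ℝ) : 0 < slitDistSq z θ := by
  rw [slitDistSq_eq_norm_sq]
  have : z - (Real.cos θ : ℂ) ≠ 0 := fun h => hz (sub_eq_zero.1 h ▸ cos_mem_slit θ)
  positivity

lemma stripPotential_eq_gaussIntegral {k : ℕ} (hk : k ≠ 0) {b : ℝ} (hb : 0 < b) (j : ℕ)
    {x : EuclideanSpace ℝ (Fin (k + 2))} (hx : planeProj (k + 1) x ∉ slit) :
    stripPotential k b j x =
      gaussIntegral stripMeasure (stripRate k b) (stripCentre k) (stripWeight k b j) x := by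
  have hI := (isGaussData_strip k hb).integrable measurable_fst
    (expIntegrable_stripWeight hk hb j) (phaseCoercive_strip k hb hx)
  unfold gaussIntegral
  unfold stripMeasure at hI ⊢
  rw [integral_prod _ hI]
  unfold stripPotential slitGauss
  congr 1
  ext lam
  rw [intervalIntegral.integral_of_le Real.pi_pos.le, ← integral_const_mul, ← integral_const_mul]
  congr 1
  ext θ
  rw [gaussPhase_strip, stripWeight, neg_add, Real.exp_add]
  ring

lemma IsHarmonicOn.congr {m : ℕ} {f g : EuclideanSpace ℝ (Fin m) → ℝ}
    {U : Set (EuclideanSpace ℝ (Fin m))} (hf : IsHarmonicOn f U) (hU : IsOpen U)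
    (h : ∀ x ∈ U, g x = f x) : IsHarmonicOn g U := by
  refine ⟨hf.1.congr h, fun x hx => ?_⟩
  have h1 : ∀ᶠ y in nhds x, g =ᶠ[nhds y] f := by
    filter_upwards [hU.mem_nhds hx] with y hy
    filter_upwards [hU.mem_nhds hy] with w hw using h w hw
  rw [← hf.2 x hx]
  refine Finset.sum_congr rfl fun i _ => ?_
  congr 1
  refine Filter.EventuallyEq.fderiv_eq ?_
  filter_upwards [h1] with y hy
  rw [hy.fderiv_eq]

lemma isHarmonicOn_stripPotential {k : ℕ} (hk : k ≠ 0) {b : ℝ} (hb : 0 < b) (j : ℕ) :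
    IsHarmonicOn (stripPotential k b j) (planeProj (k + 1) ⁻¹' slitᶜ) := by
  have hU : IsOpen (planeProj (k + 1) ⁻¹' slitᶜ) :=
    isClosed_slit.isOpen_compl.preimage (planeProj (k + 1)).continuous
  have key : IsHarmonicOn (gaussIntegral stripMeasure (stripRate k b) (stripCentre k)
      (stripWeight k b j)) (planeProj (k + 1) ⁻¹' slitᶜ) := by
    refine (isGaussData_strip k hb).isHarmonicOn measurable_fst hU
      (fun x hx => phaseCoercive_strip k hb hx) (expIntegrable_stripWeight hk hb j)
      fun x hx hintg => ?_
    simp only [laplacian_symbol_strip, gaussPhase_strip, stripWeight] at hintg ⊢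
    unfold stripMeasure at hintg ⊢
    rw [integral_prod_symm _ hintg]
    refine integral_eq_zero_of_ae ?_
    filter_upwards [hintg.prod_left_ae] with θ hθ
    exact integral_laplacian_strip k hb (slitDistSq_pos hx θ) (midNormSq_nonneg x) _ hθ
  exact key.congr hU fun x hx => stripPotential_eq_gaussIntegral hk hb j hx

end Harmonic

lemma exists_abs_slitGauss_le :
    ∃ C, 0 ≤ C ∧ ∀ (j : ℕ) (lam : ℝ), 0 < lam → ∀ z,
      |slitGauss j lam z| ≤ C * lam ^ (-(1 / 8) : ℝ) := by
  obtain ⟨C, hC, h⟩ := exists_integral_exp_neg_slitDistSq_le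
  exact ⟨C, hC, fun j lam hl z => (abs_slitGauss_le_integral j lam z).trans (h lam hl z)⟩

lemma inv_mul_le_tailBound {g A B lam : ℝ} (hl : 0 < lam) (hA : 0 ≤ A) (hB : 0 ≤ B)
    (h1 : lam ≤ 1 → |g| ≤ A * lam) (h2 : 1 < lam → |g| ≤ B * lam ^ (-(1 / 8) : ℝ)) :
    lam⁻¹ * |g| ≤ (A + B) * tailBound lam := by
  unfold tailBound
  split_ifs with h
  · have h3 : 1 ≤ lam ^ (-(1 / 2) : ℝ) :=
      Real.one_le_rpow_of_pos_of_le_one_of_nonpos hl h (by norm_num)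
    calc lam⁻¹ * |g| ≤ lam⁻¹ * (A * lam) := by gcongr; exact h1 h
      _ = A * 1 := by field_simp
      _ ≤ (A + B) * lam ^ (-(1 / 2) : ℝ) := by gcongr; linarith
  · have h := not_le.1 h
    calc lam⁻¹ * |g| ≤ lam⁻¹ * (B * lam ^ (-(1 / 8) : ℝ)) := by gcongr; exact h2 h
      _ = B * lam ^ (-(9 / 8) : ℝ) := by
        rw [← Real.rpow_neg_one, mul_left_comm, ← Real.rpow_add hl]; norm_num
      _ ≤ _ := by gcongr; linarith

lemma midWeight_mul_le_tailBound {k : ℕ} (hk : k ≠ 0) {b : ℝ} (hb : 0 < b) {g A B lam : ℝ}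
    (hl : 0 < lam) (hA : 0 ≤ A) (hB : 0 ≤ B)
    (h1 : |g| ≤ A) (h2 : 1 < lam → |g| ≤ B * lam ^ (-(1 / 8) : ℝ)) :
    midWeight k b lam * |g| ≤ (√b * A + B) * tailBound lam := by
  unfold tailBound
  split_ifs with h
  · calc midWeight k b lam * |g| ≤ √b * lam ^ (-(1 / 2) : ℝ) * A := by
          gcongr
          exact midWeight_le_rpow hk hb hl
      _ = (√b * A) * lam ^ (-(1 / 2) : ℝ) := by ring
      _ ≤ _ := by gcongr; linarith
  · have h := not_le.1 h
    calc midWeight k b lam * |g| ≤ lam⁻¹ * (B * lam ^ (-(1 / 8) : ℝ)) := by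
          gcongr
          · exact midWeight_le_inv k hb hl
          · exact h2 h
      _ = B * lam ^ (-(9 / 8) : ℝ) := by
        rw [← Real.rpow_neg_one, mul_left_comm, ← Real.rpow_add hl]; norm_num
      _ ≤ _ := by gcongr; linarith [mul_nonneg (Real.sqrt_nonneg b) hA]

/-- The integrand of the strip potential. -/
def stripKernel (k : ℕ) (b : ℝ) (j : ℕ) (lam : ℝ) (x : EuclideanSpace ℝ (Fin (k + 2))) : ℝ :=
  midWeight k b lam *
    (Real.exp (-(midRate b lam * midNormSq x)) * slitGauss j lam (planeProj (k + 1) x))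

lemma measurable_slitGauss (j : ℕ) (z : ℂ) : Measurable fun lam => slitGauss j lam z :=
  ((continuous_slitGauss j).comp (by fun_prop : Continuous fun lam : ℝ => (lam, z))).measurable

lemma measurable_stripKernel (k : ℕ) (b : ℝ) (j : ℕ) (x : EuclideanSpace ℝ (Fin (k + 2))) :
    Measurable fun lam => stripKernel k b j lam x := by
  have h1 := measurable_midWeight k b
  have h2 := measurable_midRate b
  have h3 := measurable_slitGauss j (planeProj (k + 1) x)
  unfold stripKernel
  fun_prop

lemma continuous_stripKernel (k : ℕ) (b : ℝ) (j : ℕ) (lam : ℝ) :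
    Continuous fun x => stripKernel k b j lam x := by
  have h1 := continuous_midNormSq (k := k)
  have h3 : Continuous fun x => slitGauss j lam (planeProj (k + 1) x) :=
    (continuous_slitGauss j).comp
      (by fun_prop : Continuous fun x => (lam, planeProj (k + 1) x))
  unfold stripKernel
  fun_prop

lemma exp_midRate_le_one {b lam : ℝ} (hb : 0 < b) (hl : 0 < lam) {k : ℕ}
    (x : EuclideanSpace ℝ (Fin (k + 2))) :
    Real.exp (-(midRate b lam * midNormSq x)) ≤ 1 :=
  Real.exp_le_one_iff.2 (neg_nonpos.2 (mul_nonneg (midRate_pos hb hl).le (midNormSq_nonneg x)))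

lemma abs_exp_mul_slitGauss_le {b lam : ℝ} (hb : 0 < b) (hl : 0 < lam) {k : ℕ} (j : ℕ)
    (x : EuclideanSpace ℝ (Fin (k + 2))) :
    |Real.exp (-(midRate b lam * midNormSq x)) * slitGauss j lam (planeProj (k + 1) x)| ≤
      |slitGauss j lam (planeProj (k + 1) x)| := by
  rw [abs_mul, Real.abs_exp]
  exact mul_le_of_le_one_left (abs_nonneg _) (exp_midRate_le_one hb hl x)

lemma exists_abs_stripKernel_le {k : ℕ} (hk : k ≠ 0) {b : ℝ} (hb : 0 < b) (j : ℕ) :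
    ∃ C, ∀ lam, 0 < lam → ∀ x, |stripKernel k b j lam x| ≤ C * tailBound lam := by
  obtain ⟨C, hC, h⟩ := exists_abs_slitGauss_le
  refine ⟨√b * π + C, fun lam hl x => ?_⟩
  rw [stripKernel, abs_mul, abs_of_nonneg (midWeight_nonneg k b hl)]
  have h1 := abs_exp_mul_slitGauss_le hb hl j x
  exact midWeight_mul_le_tailBound hk hb hl Real.pi_pos.le hC
    (h1.trans (abs_slitGauss_le_pi j hl.le _)) fun _ => h1.trans (h j lam hl _)

lemma integrableOn_stripKernel {k : ℕ} (hk : k ≠ 0) {b : ℝ} (hb : 0 < b) (j : ℕ)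
    (x : EuclideanSpace ℝ (Fin (k + 2))) :
    IntegrableOn (fun lam => stripKernel k b j lam x) (Ioi 0) := by
  obtain ⟨C, h⟩ := exists_abs_stripKernel_le hk hb j
  refine Integrable.mono' (integrableOn_tailBound.const_mul C)
    (measurable_stripKernel k b j x).aestronglyMeasurable ?_
  filter_upwards [ae_restrict_mem measurableSet_Ioi] with lam hl using h lam hl x

lemma continuous_stripPotential {k : ℕ} (hk : k ≠ 0) {b : ℝ} (hb : 0 < b) (j : ℕ) :
    Continuous (stripPotential k b j) := by
  obtain ⟨C, h⟩ := exists_abs_stripKernel_le hk hb j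
  refine continuous_of_dominated (bound := fun lam => C * tailBound lam)
    (F := fun x lam => stripKernel k b j lam x)
    (fun x => (measurable_stripKernel k b j x).aestronglyMeasurable) (fun x => ?_)
    (integrableOn_tailBound.const_mul C)
    (Eventually.of_forall fun lam => continuous_stripKernel k b j lam)
  filter_upwards [ae_restrict_mem measurableSet_Ioi] with lam hl using h lam hl x

lemma exists_abs_stripPotential_le {k : ℕ} (hk : k ≠ 0) {b : ℝ} (hb : 0 < b) (j : ℕ) :
    ∃ C, ∀ x, |stripPotential k b j x| ≤ C := by
  obtain ⟨C, h⟩ := exists_abs_stripKernel_le hk hb j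
  refine ⟨∫ lam in Ioi 0, C * tailBound lam, fun x => ?_⟩
  refine norm_integral_le_of_norm_le (f := fun lam => stripKernel k b j lam x)
    (integrableOn_tailBound.const_mul C) ?_
  filter_upwards [ae_restrict_mem measurableSet_Ioi] with lam hl using h lam hl x

lemma norm_sq_le_slitDistSq {k : ℕ} (x : EuclideanSpace ℝ (Fin (k + 2))) (θ : ℝ) :
    ‖x‖ ^ 2 / 2 - 1 ≤ midNormSq x + slitDistSq (planeProj (k + 1) x) θ := by
  rw [EuclideanSpace.norm_sq_eq, sum_univ_midIdx]
  simp only [Real.norm_eq_abs, sq_abs, slitDistSq, planeProj_re, planeProj_im]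
  have h1 := Real.cos_sq_le_one θ
  have h2 : 0 ≤ ∑ i : Fin k, x (midIdx i) ^ 2 := midNormSq_nonneg x
  rw [midNormSq]
  nlinarith [sq_nonneg (x 0 - 2 * Real.cos θ), sq_nonneg (x (Fin.last (k + 1)))]

lemma abs_exp_mul_slitGauss_le_exp {b lam : ℝ} (hb : 0 < b) (hl : 0 < lam) {k : ℕ} (j : ℕ)
    (x : EuclideanSpace ℝ (Fin (k + 2))) :
    |Real.exp (-(midRate b lam * midNormSq x)) * slitGauss j lam (planeProj (k + 1) x)| ≤
      π * Real.exp (-(midRate b lam * (‖x‖ ^ 2 / 2 - 1))) := by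
  rw [slitGauss, ← intervalIntegral.integral_const_mul]
  have := intervalIntegral.norm_integral_le_of_norm_le_const (a := 0) (b := π)
    (C := Real.exp (-(midRate b lam * (‖x‖ ^ 2 / 2 - 1)))) (f := fun θ =>
      Real.exp (-(midRate b lam * midNormSq x)) *
        (Real.cos (j * θ) * Real.exp (-(lam * slitDistSq (planeProj (k + 1) x) θ)))) ?_
  · rwa [sub_zero, abs_of_pos Real.pi_pos, mul_comm _ π, Real.norm_eq_abs] at this
  · intro θ _
    rw [norm_mul, norm_mul, Real.norm_eq_abs, Real.norm_eq_abs, Real.norm_eq_abs, Real.abs_exp,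
      Real.abs_exp, mul_left_comm, ← Real.exp_add]
    refine (mul_le_of_le_one_left (by positivity) (Real.abs_cos_le_one _)).trans ?_
    rw [Real.exp_le_exp]
    have h1 := mul_le_mul_of_nonneg_left (norm_sq_le_slitDistSq x θ) (midRate_pos hb hl).le
    have h2 := mul_le_mul_of_nonneg_right (midRate_le hb hl)
      (slitDistSq_nonneg (planeProj (k + 1) x) θ)
    linarith

lemma tendsto_stripPotential_cobounded {k : ℕ} (hk : k ≠ 0) {b : ℝ} (hb : 0 < b) (j : ℕ) :
    Tendsto (stripPotential k b j) (Bornology.cobounded _) (nhds 0) := by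
  obtain ⟨C, h⟩ := exists_abs_stripKernel_le hk hb j
  have hgen : (Bornology.cobounded (EuclideanSpace ℝ (Fin (k + 2)))).IsCountablyGenerated := by
    rw [← comap_norm_atTop]
    infer_instance
  have key := tendsto_integral_filter_of_dominated_convergence
    (l := Bornology.cobounded (EuclideanSpace ℝ (Fin (k + 2))))
    (μ := volume.restrict (Ioi (0 : ℝ)))
    (F := fun x lam => stripKernel k b j lam x) (f := fun _ => 0)
    (fun lam => C * tailBound lam)
    (Eventually.of_forall fun x => (measurable_stripKernel k b j x).aestronglyMeasurable)
    (Eventually.of_forall fun x => by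
      filter_upwards [ae_restrict_mem measurableSet_Ioi] with lam hl using h lam hl x)
    (integrableOn_tailBound.const_mul C) ?_
  · rwa [integral_zero] at key
  filter_upwards [ae_restrict_mem measurableSet_Ioi] with lam hl
  have hl : 0 < lam := hl
  have h1 : Tendsto (fun x : EuclideanSpace ℝ (Fin (k + 2)) =>
      midRate b lam * (‖x‖ ^ 2 / 2 - 1)) (Bornology.cobounded _) atTop := by
    refine Tendsto.const_mul_atTop (midRate_pos hb hl) ?_
    refine tendsto_atTop_add_const_right _ _ (Tendsto.atTop_div_const two_pos ?_)
    exact (tendsto_pow_atTop two_ne_zero).comp tendsto_norm_cobounded_atTop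
  have h2 : Tendsto (fun x : EuclideanSpace ℝ (Fin (k + 2)) => midWeight k b lam *
      (π * Real.exp (-(midRate b lam * (‖x‖ ^ 2 / 2 - 1))))) (Bornology.cobounded _)
      (nhds (midWeight k b lam * (π * 0))) :=
    ((Real.tendsto_exp_neg_atTop_nhds_zero.comp h1).const_mul _).const_mul _
  simp only [mul_zero] at h2
  refine squeeze_zero_norm (fun x => ?_) h2
  rw [Real.norm_eq_abs, stripKernel, abs_mul, abs_of_nonneg (midWeight_nonneg k b hl)]
  exact mul_le_mul_of_nonneg_left (abs_exp_mul_slitGauss_le_exp hb hl j x)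
    (midWeight_nonneg k b hl)

lemma IsHarmonicMeasure.stripPotential_eq {k : ℕ} (hk : k ≠ 0) {b : ℝ} (hb : 0 < b) (j : ℕ)
    {p : EuclideanSpace ℝ (Fin (k + 2))} {ω : Measure (EuclideanSpace ℝ (Fin (k + 2)))}
    (hω : IsHarmonicMeasure (planeProj (k + 1) ⁻¹' slitᶜ) p ω) :
    stripPotential k b j p = ∫ x, stripPotential k b j x ∂ω := by
  obtain ⟨C, hC⟩ := exists_abs_stripPotential_le hk hb j
  exact hω.2.2 _ (continuous_stripPotential hk hb j) (isBounded_range_of_abs_le hC)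
    (isHarmonicOn_stripPotential hk hb j) fun _ => tendsto_stripPotential_cobounded hk hb j

lemma exists_inv_mul_abs_slitGaussDiff_le :
    ∃ C, ∀ R, 0 ≤ R → ∀ (j : ℕ) (lam : ℝ), 0 < lam → ∀ z, ‖z‖ ≤ R →
      lam⁻¹ * |slitGaussDiff j lam z| ≤ (((R + 1) ^ 2 + 1) * π + C) * tailBound lam := by
  obtain ⟨C, hC, h⟩ := exists_abs_slitGauss_le
  refine ⟨C + π, fun R hR j lam hl z hz => ?_⟩
  refine inv_mul_le_tailBound hl (by positivity) (by positivity) (fun _ => ?_) fun _ => ?_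
  · refine (abs_slitGaussDiff_le j hl.le z).trans ?_
    rw [mul_assoc, mul_comm lam]
    gcongr
  · have hC' := h j lam hl z
    have h1 : 0 ≤ lam ^ (-(1 / 8) : ℝ) := by positivity
    rcases eq_or_ne j 0 with rfl | hj
    · rw [slitGaussDiff_zero]
      have h2 := mul_le_mul_of_nonneg_left (exp_neg_le_rpow hl) Real.pi_pos.le
      have h3 : |π * Real.exp (-lam)| = π * Real.exp (-lam) := abs_of_pos (by positivity)
      have h4 := abs_sub (slitGauss 0 lam z) (π * Real.exp (-lam))
      linarith
    · rw [slitGaussDiff_of_ne_zero hj]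
      nlinarith [Real.pi_pos]

lemma measurable_slitGaussDiff (j : ℕ) (z : ℂ) : Measurable fun lam => slitGaussDiff j lam z :=
  ((continuous_slitGaussDiff j).comp (by fun_prop : Continuous fun lam : ℝ => (lam, z))).measurable

/-- The logarithmic potential, as a superposition of Gaussian potentials. -/
def slitPotential (j : ℕ) (z : ℂ) : ℝ := ∫ lam in Ioi 0, lam⁻¹ * slitGaussDiff j lam z

lemma measurable_inv_mul_slitGaussDiff (j : ℕ) (z : ℂ) :
    Measurable fun lam => lam⁻¹ * slitGaussDiff j lam z := by
  have := measurable_slitGaussDiff j z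
  fun_prop

lemma abs_inv_mul {lam : ℝ} (hl : 0 < lam) (g : ℝ) : |lam⁻¹ * g| = lam⁻¹ * |g| := by
  rw [abs_mul, abs_of_pos (inv_pos.2 hl)]

lemma continuous_slitPotential (j : ℕ) : Continuous (slitPotential j) := by
  obtain ⟨C, h⟩ := exists_inv_mul_abs_slitGaussDiff_le
  rw [continuous_iff_continuousAt]
  intro z
  refine continuousAt_of_dominated
    (bound := fun lam => (((‖z‖ + 1 + 1) ^ 2 + 1) * π + C) * tailBound lam)
    (Eventually.of_forall fun x => (measurable_inv_mul_slitGaussDiff j x).aestronglyMeasurable) ?_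
    (integrableOn_tailBound.const_mul _) ?_
  · have h1 : ∀ᶠ x : ℂ in nhds z, ‖x‖ < ‖z‖ + 1 :=
      continuous_norm.continuousAt.eventually_lt continuousAt_const (by simp)
    filter_upwards [h1] with x hx
    filter_upwards [ae_restrict_mem measurableSet_Ioi] with lam hl
    rw [Real.norm_eq_abs, abs_inv_mul hl]
    exact h _ (by positivity) j lam hl x hx.le
  · refine Eventually.of_forall fun lam => ?_
    have : Continuous fun x => slitGaussDiff j lam x :=
      (continuous_slitGaussDiff j).comp (by fun_prop : Continuous fun x : ℂ => (lam, x))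
    exact (this.const_mul _).continuousAt

lemma tendsto_mul_midRate {lam : ℝ} (hl : 0 < lam) :
    Tendsto (fun b => b * midRate b lam) atTop (nhds 1) := by
  have h1 : Tendsto (fun b : ℝ => 1 + b * lam) atTop atTop :=
    tendsto_atTop_add_const_left _ _ (tendsto_id.atTop_mul_const hl)
  have h2 : Tendsto (fun b : ℝ => 1 - (1 + b * lam)⁻¹) atTop (nhds (1 - 0)) :=
    tendsto_const_nhds.sub (tendsto_inv_atTop_zero.comp h1)
  rw [sub_zero] at h2
  refine h2.congr' ?_
  filter_upwards [eventually_gt_atTop 0] with b hb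
  have : 1 + b * lam ≠ 0 := by positivity
  unfold midRate
  field_simp
  ring

lemma tendsto_midRate {lam : ℝ} (hl : 0 < lam) :
    Tendsto (fun b => midRate b lam) atTop (nhds 0) := by
  have h1 := (tendsto_mul_midRate hl).mul tendsto_inv_atTop_zero
  rw [mul_zero] at h1
  refine h1.congr' ?_
  filter_upwards [eventually_gt_atTop 0] with b hb
  field_simp

lemma tendsto_midWeight (k : ℕ) {lam : ℝ} (hl : 0 < lam) :
    Tendsto (fun b => midWeight k b lam) atTop (nhds lam⁻¹) := by
  have h1 := (((tendsto_mul_midRate hl).sqrt).pow k).const_mul lam⁻¹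
  simpa [midWeight] using h1

lemma exists_abs_stripKernel_le_of_ne_zero (k : ℕ) {j : ℕ} (hj : j ≠ 0) :
    ∃ C, ∀ R, 0 ≤ R → ∀ b, 0 < b → ∀ lam, 0 < lam → ∀ x : EuclideanSpace ℝ (Fin (k + 2)),
      ‖planeProj (k + 1) x‖ ≤ R →
        |stripKernel k b j lam x| ≤ (((R + 1) ^ 2 + 1) * π + C) * tailBound lam := by
  obtain ⟨C, h⟩ := exists_inv_mul_abs_slitGaussDiff_le
  refine ⟨C, fun R hR b hb lam hl x hx => ?_⟩
  refine le_trans ?_ (h R hR j lam hl _ hx)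
  rw [stripKernel, abs_mul, abs_of_nonneg (midWeight_nonneg k b hl), slitGaussDiff_of_ne_zero hj]
  exact mul_le_mul (midWeight_le_inv k hb hl) (abs_exp_mul_slitGauss_le hb hl j x)
    (abs_nonneg _) (by positivity)

lemma tendsto_stripPotential (k : ℕ) {j : ℕ} (hj : j ≠ 0) (x : EuclideanSpace ℝ (Fin (k + 2))) :
    Tendsto (fun b => stripPotential k b j x) atTop
      (nhds (slitPotential j (planeProj (k + 1) x))) := by
  obtain ⟨C, h⟩ := exists_abs_stripKernel_le_of_ne_zero k hj
  refine tendsto_integral_filter_of_dominated_convergence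
    (F := fun b lam => stripKernel k b j lam x)
    (fun lam => (((‖planeProj (k + 1) x‖ + 1) ^ 2 + 1) * π + C) * tailBound lam)
    (Eventually.of_forall fun b => (measurable_stripKernel k b j x).aestronglyMeasurable) ?_
    (integrableOn_tailBound.const_mul _) ?_
  · filter_upwards [eventually_gt_atTop 0] with b hb
    filter_upwards [ae_restrict_mem measurableSet_Ioi] with lam hl
    exact h _ (norm_nonneg _) b hb lam hl x le_rfl
  · filter_upwards [ae_restrict_mem measurableSet_Ioi] with lam hl
    have h1 : Tendsto (fun b => Real.exp (-(midRate b lam * midNormSq x))) atTop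
        (nhds (Real.exp (-(0 * midNormSq x)))) :=
      (Real.continuous_exp.tendsto _).comp ((tendsto_midRate hl).mul_const _).neg
    have h2 := (tendsto_midWeight k hl).mul
      (h1.mul_const (slitGauss j lam (planeProj (k + 1) x)))
    rw [zero_mul, neg_zero, Real.exp_zero, one_mul] at h2
    rwa [slitGaussDiff_of_ne_zero hj]

lemma norm_le_one_of_mem_slit {z : ℂ} (hz : z ∈ slit) : ‖z‖ ≤ 1 := by
  obtain ⟨φ, rfl⟩ := slit_eq_cos hz
  rw [Complex.norm_real]
  exact Real.abs_cos_le_one φ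

lemma frontier_preimage_compl_slit_subset (k : ℕ) :
    frontier (planeProj k ⁻¹' slitᶜ) ⊆ planeProj k ⁻¹' slit := by
  rw [preimage_compl, frontier_compl]
  exact (isClosed_slit.preimage (planeProj k).continuous).frontier_subset

lemma IsHarmonicMeasure.ae_mem_slit {k : ℕ} {p : EuclideanSpace ℝ (Fin (k + 1))}
    {ω : Measure (EuclideanSpace ℝ (Fin (k + 1)))}
    (hω : IsHarmonicMeasure (planeProj k ⁻¹' slitᶜ) p ω) : ∀ᵐ x ∂ω, planeProj k x ∈ slit :=
  measure_mono_null (compl_subset_compl.2 (frontier_preimage_compl_slit_subset k)) hω.1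

lemma IsHarmonicMeasure.isFiniteMeasure {m : ℕ} {Ω : Set (EuclideanSpace ℝ (Fin m))}
    {p : EuclideanSpace ℝ (Fin m)} {ω : Measure (EuclideanSpace ℝ (Fin m))}
    (hω : IsHarmonicMeasure Ω p ω) : IsFiniteMeasure ω :=
  ⟨hω.2.1.trans_lt ENNReal.one_lt_top⟩

lemma IsHarmonicMeasure.slitPotential_eq {k : ℕ} (hk : k ≠ 0) {j : ℕ} (hj : j ≠ 0)
    {p : EuclideanSpace ℝ (Fin (k + 2))} {ω : Measure (EuclideanSpace ℝ (Fin (k + 2)))}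
    (hω : IsHarmonicMeasure (planeProj (k + 1) ⁻¹' slitᶜ) p ω) :
    slitPotential j (planeProj (k + 1) p) = ∫ x, slitPotential j (planeProj (k + 1) x) ∂ω := by
  have := hω.isFiniteMeasure
  obtain ⟨C, h⟩ := exists_abs_stripKernel_le_of_ne_zero k hj
  refine tendsto_nhds_unique (tendsto_stripPotential k hj p) ?_
  have key : Tendsto (fun b => ∫ x, stripPotential k b j x ∂ω) atTop
      (nhds (∫ x, slitPotential j (planeProj (k + 1) x) ∂ω)) := by
    refine tendsto_integral_filter_of_dominated_convergence
      (fun _ => ∫ lam in Ioi 0, (((1 + 1) ^ 2 + 1) * π + C) * tailBound lam) ?_ ?_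
      (integrable_const _) (Eventually.of_forall fun x => tendsto_stripPotential k hj x)
    · filter_upwards [eventually_gt_atTop 0] with b hb
      exact (continuous_stripPotential hk hb j).aestronglyMeasurable
    · filter_upwards [eventually_gt_atTop 0] with b hb
      filter_upwards [hω.ae_mem_slit] with x hx
      refine norm_integral_le_of_norm_le (f := fun lam => stripKernel k b j lam x)
        (integrableOn_tailBound.const_mul _) ?_
      filter_upwards [ae_restrict_mem measurableSet_Ioi] with lam hl
      exact h 1 zero_le_one b hb lam hl x (norm_le_one_of_mem_slit hx)
  refine key.congr' ?_
  filter_upwards [eventually_gt_atTop 0] with b hb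
  exact (hω.stripPotential_eq hk hb j).symm

/-- The size of the strip potential of order zero. -/
def stripLevel (k : ℕ) (b : ℝ) : ℝ := ∫ lam in Ioi 0, midWeight k b lam * (π * Real.exp (-lam))

lemma integrableOn_stripLevel {k : ℕ} (hk : k ≠ 0) {b : ℝ} (hb : 0 < b) :
    IntegrableOn (fun lam => midWeight k b lam * (π * Real.exp (-lam))) (Ioi 0) := by
  have hm := measurable_midWeight k b
  refine Integrable.mono' (g := fun lam => (√b * π + π) * tailBound lam)
    (integrableOn_tailBound.const_mul _)
    (by fun_prop : Measurable fun lam => midWeight k b lam *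
      (π * Real.exp (-lam))).aestronglyMeasurable ?_
  filter_upwards [ae_restrict_mem measurableSet_Ioi] with lam hl
  have hl : 0 < lam := hl
  rw [Real.norm_eq_abs, abs_mul, abs_of_nonneg (midWeight_nonneg k b hl)]
  have h3 : |π * Real.exp (-lam)| = π * Real.exp (-lam) := abs_of_pos (by positivity)
  refine midWeight_mul_le_tailBound hk hb hl Real.pi_pos.le Real.pi_pos.le ?_ fun _ => ?_
  · rw [h3]
    exact mul_le_of_le_one_right Real.pi_pos.le (Real.exp_le_one_iff.2 (by linarith))
  · rw [h3]
    exact mul_le_mul_of_nonneg_left (exp_neg_le_rpow hl) Real.pi_pos.le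

lemma inv_two_le_mul_midRate {b lam : ℝ} (hb : 0 < b) (h : b⁻¹ ≤ lam) :
    2⁻¹ ≤ b * midRate b lam := by
  have h1 : 1 ≤ b * lam := by
    have := mul_le_mul_of_nonneg_left h hb.le
    rwa [mul_inv_cancel₀ hb.ne'] at this
  unfold midRate
  rw [← mul_div_assoc, le_div_iff₀ (by positivity)]
  linarith

lemma tendsto_stripLevel {k : ℕ} (hk : k ≠ 0) : Tendsto (stripLevel k) atTop atTop := by
  set c : ℝ := √(2⁻¹) ^ k * (π * Real.exp (-1)) with hc
  have hc0 : 0 < c := by positivity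
  have h1 : Tendsto (fun b => c * Real.log b) atTop atTop :=
    Real.tendsto_log_atTop.const_mul_atTop hc0
  refine tendsto_atTop_mono' _ ?_ h1
  filter_upwards [eventually_ge_atTop 1] with b hb1
  have hb : 0 < b := by linarith
  have hbi : 0 < b⁻¹ := inv_pos.2 hb
  have hle : b⁻¹ ≤ 1 := inv_le_one_of_one_le₀ hb1
  have hsub : Ioc b⁻¹ 1 ⊆ Ioi 0 := fun x hx => hbi.trans hx.1
  have h2 : c * Real.log b = ∫ lam in Ioc b⁻¹ 1, c * lam⁻¹ := by
    rw [integral_const_mul, ← intervalIntegral.integral_of_le hle,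
      integral_inv_of_pos hbi one_pos]
    simp
  rw [h2]
  calc ∫ lam in Ioc b⁻¹ 1, c * lam⁻¹
      ≤ ∫ lam in Ioc b⁻¹ 1, midWeight k b lam * (π * Real.exp (-lam)) := by
        refine setIntegral_mono_on ?_ ((integrableOn_stripLevel hk hb).mono_set hsub)
          measurableSet_Ioc fun lam hl => ?_
        · rw [← intervalIntegrable_iff_integrableOn_Ioc_of_le hle]
          refine (intervalIntegral.intervalIntegrable_inv (fun x hx => ?_)
            continuousOn_id).const_mul c
          rw [uIcc_of_le hle] at hx
          exact (hbi.trans_le hx.1).ne'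
        · have hl0 : 0 < lam := hbi.trans hl.1
          have h3 := inv_two_le_mul_midRate hb hl.1.le
          calc c * lam⁻¹ = lam⁻¹ * √(2⁻¹) ^ k * (π * Real.exp (-1)) := by rw [hc]; ring
            _ ≤ lam⁻¹ * √(b * midRate b lam) ^ k * (π * Real.exp (-lam)) := by
              gcongr
              exact hl.2
    _ ≤ stripLevel k b := by
        refine setIntegral_mono_set (integrableOn_stripLevel hk hb) ?_ hsub.eventuallyLE
        filter_upwards [ae_restrict_mem measurableSet_Ioi] with lam hl
        exact mul_nonneg (midWeight_nonneg k b hl) (by positivity)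

lemma stripPotential_sub_stripLevel {k : ℕ} (hk : k ≠ 0) {b : ℝ} (hb : 0 < b)
    (x : EuclideanSpace ℝ (Fin (k + 2))) :
    stripPotential k b 0 x - stripLevel k b =
      ∫ lam in Ioi 0, (stripKernel k b 0 lam x - midWeight k b lam * (π * Real.exp (-lam))) :=
  (integral_sub (integrableOn_stripKernel hk hb 0 x) (integrableOn_stripLevel hk hb)).symm

lemma exists_stripPotential_le_stripLevel_add {k : ℕ} (hk : k ≠ 0) :
    ∃ C, 0 ≤ C ∧ ∀ b, 0 < b → ∀ x : EuclideanSpace ℝ (Fin (k + 2)), planeProj (k + 1) x ∈ slit →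
      stripPotential k b 0 x ≤ stripLevel k b + C := by
  obtain ⟨C, h⟩ := exists_inv_mul_abs_slitGaussDiff_le
  refine ⟨|∫ lam in Ioi 0, (((1 + 1) ^ 2 + 1) * π + C) * tailBound lam|, abs_nonneg _,
    fun b hb x hx => ?_⟩
  refine sub_le_iff_le_add'.1 (le_trans ?_ (le_abs_self _))
  rw [stripPotential_sub_stripLevel hk hb]
  refine setIntegral_mono_on
    ((integrableOn_stripKernel hk hb 0 x).sub (integrableOn_stripLevel hk hb))
    (integrableOn_tailBound.const_mul _) measurableSet_Ioi fun lam hl => ?_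
  have hl : 0 < lam := hl
  refine le_trans ?_ (h 1 zero_le_one 0 lam hl _ (norm_le_one_of_mem_slit hx))
  rw [stripKernel, ← mul_sub]
  have h1 := mul_le_of_le_one_left (slitGauss_zero_nonneg lam (planeProj (k + 1) x))
    (exp_midRate_le_one hb hl x)
  calc _ ≤ midWeight k b lam * |slitGaussDiff 0 lam (planeProj (k + 1) x)| := by
        refine mul_le_mul_of_nonneg_left (le_trans ?_ (le_abs_self _)) (midWeight_nonneg k b hl)
        rw [slitGaussDiff_zero]
        linarith
    _ ≤ _ := mul_le_mul_of_nonneg_right (midWeight_le_inv k hb hl) (abs_nonneg _)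

lemma exists_stripLevel_sub_le_stripPotential {k : ℕ} (hk : k ≠ 0)
    (x : EuclideanSpace ℝ (Fin (k + 2))) :
    ∃ C, ∀ b, 0 < b → stripLevel k b - C ≤ stripPotential k b 0 x := by
  obtain ⟨C, h⟩ := exists_inv_mul_abs_slitGaussDiff_le
  obtain ⟨C', hC', h'⟩ := exists_abs_slitGauss_le
  set z := planeProj (k + 1) x
  set q := midNormSq x
  have hq : 0 ≤ q := midNormSq_nonneg x
  refine ⟨∫ lam in Ioi 0, ((((‖z‖ + 1) ^ 2 + 1) * π + C) * tailBound lam +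
    (q * π + C') * tailBound lam), fun b hb => ?_⟩
  rw [sub_le_comm, ← neg_sub (stripPotential k b 0 x), stripPotential_sub_stripLevel hk hb,
    ← integral_neg]
  refine setIntegral_mono_on
    ((integrableOn_stripKernel hk hb 0 x).sub (integrableOn_stripLevel hk hb)).neg
    ((integrableOn_tailBound.const_mul _).add (integrableOn_tailBound.const_mul _))
    measurableSet_Ioi fun lam hl => ?_
  have hl : 0 < lam := hl
  have hG := slitGauss_zero_nonneg lam z
  have hG' : slitGauss 0 lam z ≤ π := (le_abs_self _).trans (abs_slitGauss_le_pi 0 hl.le z)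
  set e := Real.exp (-(midRate b lam * q)) with he
  have he1 : e ≤ 1 := exp_midRate_le_one hb hl x
  have he0 : 0 < e := Real.exp_pos _
  have he2 : 1 - e ≤ lam * q := by
    have h1 := Real.add_one_le_exp (-(midRate b lam * q))
    have h2 := mul_le_mul_of_nonneg_right (midRate_le hb hl) hq
    linarith
  have hw := midWeight_le_inv k hb hl
  have hw0 := midWeight_nonneg k b hl
  have hs : 0 ≤ (1 - e) * slitGauss 0 lam z := mul_nonneg (by linarith) hG
  have h2 : lam⁻¹ * |(1 - e) * slitGauss 0 lam z| ≤ (q * π + C') * tailBound lam := by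
    rw [abs_of_nonneg hs]
    have := inv_mul_le_tailBound (g := (1 - e) * slitGauss 0 lam z) hl
      (by positivity : 0 ≤ q * π) hC' (fun _ => ?_) fun _ => ?_
    · rwa [abs_of_nonneg hs] at this
    · rw [abs_of_nonneg hs]
      calc (1 - e) * slitGauss 0 lam z ≤ (lam * q) * π :=
            mul_le_mul he2 hG' hG (by positivity)
        _ = q * π * lam := by ring
    · rw [abs_of_nonneg hs]
      refine le_trans ?_ ((le_abs_self _).trans (h' 0 lam hl z))
      exact mul_le_of_le_one_left hG (by linarith)
  refine le_trans ?_ (add_le_add (h _ (norm_nonneg z) 0 lam hl z le_rfl) h2)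
  rw [abs_of_nonneg hs]
  have h3 : -(stripKernel k b 0 lam x - midWeight k b lam * (π * Real.exp (-lam))) =
      midWeight k b lam * (-slitGaussDiff 0 lam z + (1 - e) * slitGauss 0 lam z) := by
    rw [stripKernel, slitGaussDiff_zero]
    ring
  rw [h3, ← mul_add]
  have h4 := neg_le_abs (slitGaussDiff 0 lam z)
  calc _ ≤ midWeight k b lam * (|slitGaussDiff 0 lam z| + (1 - e) * slitGauss 0 lam z) := by
        gcongr
    _ ≤ _ := mul_le_mul_of_nonneg_right hw (by positivity)

lemma IsHarmonicMeasure.measureReal_univ {k : ℕ} (hk : k ≠ 0)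
    {p : EuclideanSpace ℝ (Fin (k + 2))} {ω : Measure (EuclideanSpace ℝ (Fin (k + 2)))}
    (hω : IsHarmonicMeasure (planeProj (k + 1) ⁻¹' slitᶜ) p ω) : ω.real univ = 1 := by
  have := hω.isFiniteMeasure
  have hle : ω.real univ ≤ 1 := by
    have := ENNReal.toReal_mono ENNReal.one_ne_top hω.2.1
    simpa [measureReal_def] using this
  refine hle.antisymm (not_lt.1 fun hlt => ?_)
  obtain ⟨C₁, hC₁, h₁⟩ := exists_stripPotential_le_stripLevel_add hk
  obtain ⟨C₂, h₂⟩ := exists_stripLevel_sub_le_stripPotential hk p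
  have h3 : ∀ b, 0 < b → (1 - ω.real univ) * stripLevel k b ≤ C₂ + ω.real univ * C₁ := by
    intro b hb
    obtain ⟨C, hC⟩ := exists_abs_stripPotential_le hk hb 0
    have h4 : ∫ x, stripPotential k b 0 x ∂ω ≤ ∫ _, (stripLevel k b + C₁) ∂ω := by
      refine integral_mono_ae ?_ (integrable_const _) ?_
      · exact Integrable.of_bound (continuous_stripPotential hk hb 0).aestronglyMeasurable C
          (Eventually.of_forall hC)
      · filter_upwards [hω.ae_mem_slit] with x hx using h₁ b hb x hx
    rw [← hω.stripPotential_eq hk hb 0, integral_const, smul_eq_mul] at h4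
    linarith [h₂ b hb]
  have h4 := (tendsto_stripLevel hk).const_mul_atTop (sub_pos.2 hlt)
  obtain ⟨b, hb, hb'⟩ := ((eventually_gt_atTop 0).and
    (h4.eventually_gt_atTop (C₂ + ω.real univ * C₁))).exists
  exact absurd (h3 b hb) (not_le.2 hb')

lemma abs_exp_neg_mul_sub_le {r c lam : ℝ} (hc : c ≤ 1) (hcr : c ≤ r) (hl : 0 ≤ lam) :
    |Real.exp (-(lam * r)) - Real.exp (-lam)| ≤ lam * |r - 1| * Real.exp (-c * lam) := by
  have h1 : Real.exp (-(lam * r)) - Real.exp (-lam) = Real.exp (-c * lam) *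
      (Real.exp (-(lam * (r - c))) - Real.exp (-(lam * (1 - c)))) := by
    rw [mul_sub, ← Real.exp_add, ← Real.exp_add]
    ring_nf
  have h2 := abs_exp_neg_sub_exp_neg_le (mul_nonneg hl (sub_nonneg.2 hcr))
    (mul_nonneg hl (sub_nonneg.2 hc))
  rw [show lam * (r - c) - lam * (1 - c) = lam * (r - 1) by ring, abs_mul, abs_of_nonneg hl] at h2
  rw [h1, abs_mul, Real.abs_exp, mul_comm]
  gcongr

lemma abs_inv_mul_exp_neg_mul_sub_le {r c lam : ℝ} (hc : c ≤ 1) (hcr : c ≤ r) (hl : 0 < lam) :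
    |lam⁻¹ * (Real.exp (-(lam * r)) - Real.exp (-lam))| ≤ |r - 1| * Real.exp (-c * lam) := by
  rw [abs_inv_mul hl, inv_mul_le_iff₀ hl, ← mul_assoc]
  exact abs_exp_neg_mul_sub_le hc hcr hl.le

/-- The logarithm as a Frullani integral. -/
lemma integral_inv_mul_exp_neg_sub {r : ℝ} (hr : 0 < r) :
    ∫ lam in Ioi 0, lam⁻¹ * (Real.exp (-(lam * r)) - Real.exp (-lam)) = -Real.log r := by
  have hintg : IntegrableOn (fun lam : ℝ => lam⁻¹ * (Real.exp (-(lam * r)) - Real.exp (-lam)))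
      (Ioi 0) := by
    refine Integrable.mono' (g := fun lam => |r - 1| * Real.exp (-(min r 1) * lam))
      ((exp_neg_integrableOn_Ioi 0 (lt_min hr one_pos)).const_mul _)
      (by fun_prop : Measurable fun lam : ℝ =>
        lam⁻¹ * (Real.exp (-(lam * r)) - Real.exp (-lam))).aestronglyMeasurable ?_
    filter_upwards [ae_restrict_mem measurableSet_Ioi] with lam hl
    exact abs_inv_mul_exp_neg_mul_sub_le (min_le_right _ _) (min_le_left _ _) hl
  have hc : Continuous fun x : ℝ => Real.exp (-x) := by fun_prop
  have h := Frullani.integral_Ioi_eq (f := fun x => Real.exp (-x)) (a := r) (b := 1) (L := 1)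
    (R := 0) (hc.continuousOn.locallyIntegrableOn measurableSet_Ioi) hr one_pos
    (by simpa using (hc.tendsto 0).mono_left nhdsWithin_le_nhds)
    Real.tendsto_exp_neg_atTop_nhds_zero
    (by simpa only [smul_eq_mul, one_mul, mul_comm r] using hintg)
  simpa only [smul_eq_mul, one_mul, mul_comm r, one_div, Real.log_inv, sub_zero, mul_one] using h

lemma slitPotential_eq_integral_log (j : ℕ) {z : ℂ} (hz : z ∉ slit) :
    slitPotential j z = ∫ θ in 0..π, Real.cos (j * θ) * -Real.log (slitDistSq z θ) := by
  have hne : slit.Nonempty := ⟨_, cos_mem_slit 0⟩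
  have hd : 0 < infDist z slit := (isClosed_slit.notMem_iff_infDist_pos hne).1 hz
  set c : ℝ := min (infDist z slit ^ 2) 1
  have hc : 0 < c := lt_min (by positivity) one_pos
  have hcr : ∀ θ, c ≤ slitDistSq z θ := by
    intro θ
    have h2 := infDist_le_dist_of_mem (x := z) (cos_mem_slit θ)
    rw [dist_eq_norm] at h2
    rw [slitDistSq_eq_norm_sq]
    exact (min_le_left _ _).trans (by gcongr)
  let F : ℝ → ℝ → ℝ := fun lam θ => lam⁻¹ * (Real.cos (j * θ) *
    (Real.exp (-(lam * slitDistSq z θ)) - Real.exp (-lam)))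
  have hintg : Integrable (Function.uncurry F)
      ((volume.restrict (Ioi 0)).prod (volume.restrict (Ioc 0 π))) := by
    have h1 : Integrable (fun _ : ℝ => ((‖z‖ + 1) ^ 2 + 1)) (volume.restrict (Ioc 0 π)) :=
      integrable_const _
    have h2 : Integrable (fun lam => Real.exp (-c * lam)) (volume.restrict (Ioi 0)) :=
      exp_neg_integrableOn_Ioi 0 hc
    refine (h2.mul_prod h1).mono' ?_ ?_
    · have h3 : Measurable fun p : ℝ × ℝ => slitDistSq z p.2 :=
        (continuous_slitDistSq_right z).measurable.comp measurable_snd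
      refine Measurable.aestronglyMeasurable ?_
      unfold Function.uncurry F
      fun_prop
    · have h4 : ∀ᵐ a ∂(volume.restrict (Ioi (0 : ℝ))).prod (volume.restrict (Ioc 0 π)),
          0 < a.1 := ae_stripMeasure
      filter_upwards [h4] with a ha
      have h0 := slitDistSq_nonneg z a.2
      have h1 := slitDistSq_le z a.2
      rw [Function.uncurry, Real.norm_eq_abs]
      simp only [F]
      rw [mul_left_comm, abs_mul]
      refine (mul_le_of_le_one_left (abs_nonneg _) (Real.abs_cos_le_one _)).trans ?_
      refine (abs_inv_mul_exp_neg_mul_sub_le (min_le_right _ _) (hcr a.2) ha).trans ?_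
      rw [mul_comm]
      gcongr
      exact abs_le.2 ⟨by nlinarith, by linarith⟩
  calc slitPotential j z = ∫ lam in Ioi 0, ∫ θ in Ioc 0 π, F lam θ := by
        unfold slitPotential slitGaussDiff
        simp only [intervalIntegral.integral_of_le Real.pi_pos.le, ← integral_const_mul, F]
    _ = ∫ θ in Ioc 0 π, ∫ lam in Ioi 0, F lam θ := integral_integral_swap hintg
    _ = _ := by
        rw [intervalIntegral.integral_of_le Real.pi_pos.le]
        congr 1
        ext θ
        rw [← integral_inv_mul_exp_neg_sub (hc.trans_le (hcr θ)), ← integral_const_mul]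
        congr 1
        ext lam
        simp only [F]
        ring

lemma norm_mul_exp_mul_I (w : ℂ) (θ : ℝ) : ‖w * Complex.exp (θ * Complex.I)‖ = ‖w‖ := by
  rw [norm_mul, Complex.norm_exp_ofReal_mul_I, mul_one]

lemma hasSum_neg_log_norm_one_sub {u : ℂ} (hu : ‖u‖ < 1) :
    HasSum (fun n : ℕ => (u ^ n).re / n) (-Real.log ‖1 - u‖) := by
  have h := Complex.hasSum_re (Complex.hasSum_taylorSeries_neg_log hu)
  rw [Complex.neg_re, Complex.log_re] at h
  refine h.congr_fun fun n => ?_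
  rw [← Complex.ofReal_natCast, Complex.div_ofReal_re]

lemma neg_log_slitDistSq {w : ℂ} (hw : w ≠ 0) (hw1 : ‖w‖ < 1) (θ : ℝ) :
    -Real.log (slitDistSq ((w + w⁻¹) / 2) θ) = 2 * -Real.log ‖1 - w * Complex.exp (θ * Complex.I)‖ +
      2 * -Real.log ‖1 - w * Complex.exp ((-θ : ℝ) * Complex.I)‖ + 2 * Real.log (2 * ‖w‖) := by
  have h1 : ∀ φ : ℝ, 0 < ‖1 - w * Complex.exp (φ * Complex.I)‖ := by
    intro φ
    rw [norm_pos_iff, sub_ne_zero]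
    intro h
    have := norm_mul_exp_mul_I w φ
    rw [← h, norm_one] at this
    linarith
  have h2 : (w + w⁻¹) / 2 - (Real.cos θ : ℂ) = (1 - w * Complex.exp (θ * Complex.I)) *
      (1 - w * Complex.exp ((-θ : ℝ) * Complex.I)) / (2 * w) := by
    have h3 : Complex.exp (θ * Complex.I) * Complex.exp ((-θ : ℝ) * Complex.I) = 1 := by
      rw [← Complex.exp_add]; simp
    rw [Complex.ofReal_cos, Complex.cos, eq_div_iff (by simpa using hw),
      show -(θ : ℂ) * Complex.I = (-θ : ℝ) * Complex.I by push_cast; ring]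
    generalize Complex.exp (θ * Complex.I) = e₁ at h3 ⊢
    generalize Complex.exp ((-θ : ℝ) * Complex.I) = e₂ at h3 ⊢
    field_simp
    linear_combination (-w ^ 2) * h3
  have hwn : 0 < ‖w‖ := norm_pos_iff.2 hw
  rw [slitDistSq_eq_norm_sq, h2, norm_div, norm_mul, norm_mul, Complex.norm_two, Real.log_pow,
    Real.log_div (mul_pos (h1 _) (h1 _)).ne' (by positivity),
    Real.log_mul (h1 _).ne' (h1 _).ne']
  push_cast
  ring

lemma hasSum_neg_log_slitDistSq {w : ℂ} (hw : w ≠ 0) (hw1 : ‖w‖ < 1) (θ : ℝ) :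
    HasSum (fun n : ℕ => 4 * (w ^ n).re / n * Real.cos (n * θ))
      (-Real.log (slitDistSq ((w + w⁻¹) / 2) θ) - 2 * Real.log (2 * ‖w‖)) := by
  have h1 := fun φ : ℝ => hasSum_neg_log_norm_one_sub
    ((norm_mul_exp_mul_I w φ).trans_lt hw1)
  have h2 := ((h1 θ).mul_left 2).add ((h1 (-θ)).mul_left 2)
  rw [neg_log_slitDistSq hw hw1, add_sub_cancel_right]
  refine h2.congr_fun fun n => ?_
  have h3 : ∀ φ : ℝ, ((w * Complex.exp (φ * Complex.I)) ^ n).re =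
      (w ^ n).re * Real.cos (n * φ) - (w ^ n).im * Real.sin (n * φ) := by
    intro φ
    rw [mul_pow, ← Complex.exp_nat_mul, ← mul_assoc,
      show ((n : ℂ) * (φ : ℂ)) = ((n * φ : ℝ) : ℂ) by push_cast; ring, Complex.mul_re,
      Complex.exp_ofReal_mul_I_re, Complex.exp_ofReal_mul_I_im]
  rw [h3, h3, mul_neg, Real.cos_neg, Real.sin_neg]
  ring

lemma integral_cos_mul_cos_of_lt {n j : ℕ} (h : n < j) :
    ∫ θ in 0..π, Real.cos (n * θ) * Real.cos (j * θ) = 0 := by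
  have h1 : ∀ θ : ℝ, Real.cos (n * θ) * Real.cos (j * θ) =
      2⁻¹ * (Real.cos ((j - n : ℕ) * θ) + Real.cos ((j + n : ℕ) * θ)) := by
    intro θ
    rw [Nat.cast_sub h.le, Nat.cast_add, sub_mul, add_mul, Real.cos_sub, Real.cos_add]
    ring
  simp only [h1]
  rw [intervalIntegral.integral_const_mul, intervalIntegral.integral_add
    (Continuous.intervalIntegrable (by fun_prop) _ _)
    (Continuous.intervalIntegrable (by fun_prop) _ _),
    integral_cos_nat_mul (by omega), integral_cos_nat_mul (by omega)]
  simp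

lemma integral_cos_mul_cos_self {j : ℕ} (hj : j ≠ 0) :
    ∫ θ in 0..π, Real.cos (j * θ) * Real.cos (j * θ) = π / 2 := by
  have h1 : ∀ θ : ℝ, Real.cos (j * θ) * Real.cos (j * θ) =
      2⁻¹ * (1 + Real.cos ((2 * j : ℕ) * θ)) := by
    intro θ
    rw [Nat.cast_mul, mul_assoc, Nat.cast_two, Real.cos_two_mul]
    ring
  simp only [h1]
  rw [intervalIntegral.integral_const_mul, intervalIntegral.integral_add
    (Continuous.intervalIntegrable (by fun_prop) _ _)
    (Continuous.intervalIntegrable (by fun_prop) _ _),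
    integral_cos_nat_mul (by omega)]
  simp
  ring

lemma integral_cos_mul_neg_log_slitDistSq {w : ℂ} (hw : w ≠ 0) (hw1 : ‖w‖ < 1) {j : ℕ}
    (hj : j ≠ 0) (hintg : IntervalIntegrable
      (fun θ => Real.cos (j * θ) * -Real.log (slitDistSq ((w + w⁻¹) / 2) θ)) volume 0 π) :
    ∫ θ in 0..π, Real.cos (j * θ) * -Real.log (slitDistSq ((w + w⁻¹) / 2) θ) =
      2 * π / j * (w ^ j).re := by
  have hsum : Summable fun n : ℕ => 4 * ‖w‖ ^ n :=
    (summable_geometric_of_lt_one (norm_nonneg w) hw1).mul_left 4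
  have h1 := intervalIntegral.hasSum_integral_of_dominated_convergence (a := 0) (b := π)
    (μ := volume) (F := fun (n : ℕ) θ => 4 * (w ^ n).re / n * Real.cos (n * θ) * Real.cos (j * θ))
    (f := fun θ => (-Real.log (slitDistSq ((w + w⁻¹) / 2) θ) - 2 * Real.log (2 * ‖w‖)) *
      Real.cos (j * θ)) (fun n _ => 4 * ‖w‖ ^ n)
    (fun n => Continuous.aestronglyMeasurable (by fun_prop)) ?_
    (Eventually.of_forall fun _ _ => hsum) (by simp)
    (Eventually.of_forall fun θ _ => (hasSum_neg_log_slitDistSq hw hw1 θ).mul_right _)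
  · have h2 := h1.unique (hasSum_single j fun n hn => ?_)
    · have h3 : ∀ θ : ℝ, 4 * (w ^ j).re / j * Real.cos (j * θ) * Real.cos (j * θ) =
          4 * (w ^ j).re / j * (Real.cos (j * θ) * Real.cos (j * θ)) := fun θ => mul_assoc _ _ _
      simp only [h3, intervalIntegral.integral_const_mul, integral_cos_mul_cos_self hj,
        sub_mul] at h2
      rw [intervalIntegral.integral_sub (by simpa only [mul_comm] using hintg)
        (Continuous.intervalIntegrable (by fun_prop) _ _), intervalIntegral.integral_const_mul,
        integral_cos_nat_mul hj, mul_zero, sub_zero] at h2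
      simp only [mul_comm (Real.cos _)]
      rw [h2]
      ring
    · simp only [mul_assoc (4 * (w ^ n).re / n), intervalIntegral.integral_const_mul]
      rcases lt_or_gt_of_ne hn with h | h
      · rw [integral_cos_mul_cos_of_lt h, mul_zero]
      · simp only [mul_comm (Real.cos (n * _))]
        rw [integral_cos_mul_cos_of_lt h, mul_zero]
  · refine fun n => Eventually.of_forall fun θ _ => ?_
    rw [norm_mul, norm_mul, Real.norm_eq_abs, Real.norm_eq_abs, Real.norm_eq_abs]
    calc |4 * (w ^ n).re / n| * |Real.cos (n * θ)| * |Real.cos (j * θ)|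
        ≤ |4 * (w ^ n).re / n| * 1 * 1 := by
          gcongr <;> exact Real.abs_cos_le_one _
      _ ≤ 4 * ‖w‖ ^ n := by
          rw [mul_one, mul_one, abs_div, abs_mul, Nat.abs_cast, abs_of_pos (four_pos)]
          rcases Nat.eq_zero_or_pos n with rfl | hn
          · simp
          · refine (div_le_self (by positivity) (by exact_mod_cast hn)).trans ?_
            rw [← norm_pow]
            gcongr
            exact Complex.abs_re_le_norm _

lemma slitPotential_eq_chebHarm_of_notMem {j : ℕ} (hj : j ≠ 0) {z : ℂ} (hz : z ∉ slit) :
    slitPotential j z = 2 * π / j * chebHarm j z := by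
  obtain ⟨hw, hzw⟩ := slitMap_ne_zero_and_eq hz
  have hintg : IntervalIntegrable
      (fun θ => Real.cos (j * θ) * -Real.log (slitDistSq z θ)) volume 0 π := by
    refine Continuous.intervalIntegrable ?_ _ _
    have := (continuous_slitDistSq_right z).log fun θ => (slitDistSq_pos hz θ).ne'
    fun_prop
  rw [slitPotential_eq_integral_log j hz, chebHarm_eq_re hz]
  rw [hzw] at hintg
  conv_lhs => rw [hzw]
  exact integral_cos_mul_neg_log_slitDistSq hw (norm_slitMap_lt_one hz) hj hintg

lemma dense_compl_slit : Dense slitᶜ := by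
  refine ((dense_compl_singleton (0 : ℝ)).preimage Complex.isOpenMap_im).mono fun z hz hz' => ?_
  exact hz (mem_slit_iff.1 hz').2

lemma slitPotential_eq_chebHarm {j : ℕ} (hj : j ≠ 0) (z : ℂ) :
    slitPotential j z = 2 * π / j * chebHarm j z :=
  congrFun ((continuous_slitPotential j).ext_on dense_compl_slit
    ((continuous_chebHarm j).const_mul _) fun _ hz => slitPotential_eq_chebHarm_of_notMem hj hz) z

lemma IsHarmonicMeasure.integral_chebHarm {n : ℕ} (hn : 1 ≤ n)
    {p : EuclideanSpace ℝ (Fin (n + 1))} {ω : Measure (EuclideanSpace ℝ (Fin (n + 1)))}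
    (hω : IsHarmonicMeasure (planeProj n ⁻¹' slitᶜ) p ω) (j : ℕ) :
    ∫ x, chebHarm j (planeProj n x) ∂ω = chebHarm j (planeProj n p) := by
  obtain ⟨k, rfl⟩ := Nat.exists_eq_add_of_le' hn
  rcases eq_or_ne k 0 with rfl | hk
  · refine (hω.2.2 (fun x => chebHarm j (planeProj 1 x))
      ((continuous_chebHarm j).comp (planeProj 1).continuous)
      (isBounded_range_of_abs_le fun x => abs_chebHarm_le j _)
      (isHarmonicOn_of_re le_rfl isClosed_slit.isOpen_compl (differentiableOn_slitMap.pow j)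
        fun x hx => chebHarm_eq_re hx j) fun h => absurd h (by norm_num)).symm
  rcases eq_or_ne j 0 with rfl | hj
  · have h := hω.measureReal_univ hk
    have h0 : ∀ z, chebHarm 0 z = 1 := fun z => by simp [chebHarm]; norm_num
    simp [h0, h]
  · have h := hω.slitPotential_eq hk hj
    simp only [slitPotential_eq_chebHarm hj, integral_const_mul] at h
    exact (mul_left_cancel₀ (by positivity) h).symm

lemma IsHarmonicMeasure.hasChebMoments {n : ℕ} (hn : 1 ≤ n)
    {p : EuclideanSpace ℝ (Fin (n + 1))} {ω : Measure (EuclideanSpace ℝ (Fin (n + 1)))}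
    (hω : IsHarmonicMeasure (planeProj n ⁻¹' slitᶜ) p ω) :
    HasChebMoments (planeProj n p) (ω.map fun x => (planeProj n x).re) :=
  have := hω.isFiniteMeasure
  hasChebMoments_map (planeProj n).continuous.measurable hω.ae_mem_slit
    (hω.integral_chebHarm hn)

lemma measureReal_map_re_Icc {X : Type*} [MeasurableSpace X] {ω : Measure X} {P : X → ℂ}
    (hP : Measurable P) (hs : ∀ᵐ x ∂ω, P x ∈ slit) (a b : ℝ) :
    (ω.map fun x => (P x).re).real (Icc a b) =
      (ω {x | (P x).re ∈ Icc a b ∧ (P x).im = 0}).toReal := by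
  rw [measureReal_def, Measure.map_apply (f := fun x => (P x).re) (Complex.measurable_re.comp hP)
    measurableSet_Icc]
  congr 1
  refine measure_congr ?_
  filter_upwards [hs] with x hx
  have h := (mem_slit_iff.1 hx).2
  exact propext ⟨fun h1 => ⟨h1, h⟩, fun h1 => h1.1⟩

theorem stmt17 (n : ℕ) (hn : 1 ≤ n) (A : ℝ) (hA : 1 ≤ A)
    (a b : ℝ) (hab : a < b) (ha : -1 < a) (hb : b < 1)
    -- `dist(J, ∂I₀)` is comparable to `ℓ(J) = b - a`
    (hcomp₁ : A⁻¹ * (b - a) ≤ min (a - (-1)) (1 - b))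
    (hcomp₂ : min (a - (-1)) (1 - b) ≤ A * (b - a))
    (I₀ : Set ℂ) (hI₀ : I₀ = (fun t : ℝ => (t : ℂ)) '' Set.Icc (-1 : ℝ) 1)
    (J : Set ℂ) (hJ : J = (fun t : ℝ => (t : ℂ)) '' Set.Icc a b)
    -- `u(z) = ω_{I₀}^z(J)`: harmonic measure of `J` for `ℂ \ I₀` with pole `z`
    (ωfam : ℂ → Measure ℂ) (hfam : ∀ z ∉ I₀, IsHarmonicMeasurePoleC I₀ᶜ z (ωfam z))
    (u : ℂ → ℝ) (hu : ∀ z, u z = ((ωfam z) J).toReal)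
    (f : EuclideanSpace ℝ (Fin (n + 1)) → ℝ)
    (hf : ∀ x, f x = u ((x 0 : ℂ) + (x (Fin.last n) : ℂ) * Complex.I))
    (Itld : Set (EuclideanSpace ℝ (Fin (n + 1))))
    (hItld : Itld = {x | x 0 ∈ Set.Icc (-1 : ℝ) 1 ∧ x (Fin.last n) = 0})
    (Jtld : Set (EuclideanSpace ℝ (Fin (n + 1))))
    (hJtld : Jtld = {x | x 0 ∈ Set.Icc a b ∧ x (Fin.last n) = 0}) :
    (∀ x ∈ Itldᶜ, 0 ≤ f x ∧ f x ≤ 1) ∧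
    IsHarmonicOn f Itldᶜ ∧
    (∀ x ∈ Itld \ closure Jtld, Tendsto f (nhdsWithin x Itldᶜ) (nhds 0)) ∧
    (∀ x : EuclideanSpace ℝ (Fin (n + 1)), x 0 ∈ Set.Ioo a b → x (Fin.last n) = 0 →
      Tendsto f (nhdsWithin x Itldᶜ) (nhds 1)) ∧
    (∀ x ∈ Itldᶜ, ∀ ωtld : Measure (EuclideanSpace ℝ (Fin (n + 1))),
      IsHarmonicMeasure Itldᶜ x ωtld → f x = (ωtld Jtld).toReal) := by
  change I₀ = slit at hI₀
  subst hI₀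
  have hI : Itldᶜ = planeProj n ⁻¹' slitᶜ := by
    ext x
    simp only [hItld, mem_compl_iff, mem_preimage, mem_slit_iff, planeProj_re, planeProj_im,
      mem_ofPred_eq]
  have hJ' : J = {z | z.re ∈ Icc a b ∧ z.im = 0} := by
    rw [hJ]
    ext z
    constructor
    · rintro ⟨t, ht, rfl⟩
      exact ⟨ht, rfl⟩
    · rintro ⟨h1, h2⟩
      exact ⟨z.re, h1, Complex.ext rfl h2.symm⟩
  set m : ℂ → Measure ℝ := fun z => (ωfam z).map Complex.re with hm
  have hmom : ∀ z ∉ slit, HasChebMoments z (m z) := fun z hz => (hfam z hz).hasChebMoments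
  have hum : ∀ z ∉ slit, u z = (m z).real (Icc a b) := by
    intro z hz
    have h := measureReal_map_re_Icc (P := id) measurable_id
      (measure_mono_null Subset.rfl (hfam z hz).measure_compl_slit) a b
    rw [hu, hJ']
    exact h.symm
  have hfx : ∀ x, f x = u (planeProj n x) := fun x => by rw [hf, planeProj_apply]
  have hlim : ∀ x c, Tendsto (fun z => (m z).real (Icc a b))
      (nhdsWithin (planeProj n x) slitᶜ) (nhds c) → Tendsto f (nhdsWithin x Itldᶜ) (nhds c) := by
    intro x c h
    have h1 : Tendsto (planeProj n) (nhdsWithin x Itldᶜ) (nhdsWithin (planeProj n x) slitᶜ) := by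
      rw [hI]
      exact (planeProj n).continuous.continuousWithinAt.tendsto_nhdsWithin fun y hy => hy
    refine (h.comp h1).congr' ?_
    filter_upwards [self_mem_nhdsWithin] with y hy
    rw [hI] at hy
    rw [hfx, hum _ hy, Function.comp]
  refine ⟨fun x hx => ?_, ?_, fun x hx => ?_, fun x hx hx0 => ?_, fun x hx ωtld hω => ?_⟩
  · rw [hI] at hx
    have := (hmom _ hx).finite
    rw [hfx, hum _ hx]
    exact ⟨measureReal_nonneg, (measureReal_mono (subset_univ _)).trans_eq
      (hmom _ hx).measureReal_univ⟩
  · obtain ⟨G, hG, hGm⟩ := exists_holomorphic_measureReal a b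
    rw [hI]
    refine isHarmonicOn_of_re hn isClosed_slit.isOpen_compl (g := fun z => G (slitMap z)) ?_ ?_
    · exact hG.comp differentiableOn_slitMap fun z hz => by
        simpa using norm_slitMap_lt_one hz
    · intro x hx
      rw [hfx, hum _ hx]
      exact hGm _ hx _ (hmom _ hx)
  · have h1 : x ∉ Jtld := fun h => hx.2 (subset_closure h)
    rw [hItld] at hx
    rw [hJtld] at h1
    have h2 : planeProj n x = ((x 0 : ℝ) : ℂ) := by rw [planeProj_apply, hx.1.2]; simp
    refine hlim x 0 ?_
    rw [h2]
    exact tendsto_measureReal_zero hmom hx.1.1 fun h => h1 ⟨h, hx.1.2⟩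
  · have h2 : planeProj n x = ((x 0 : ℝ) : ℂ) := by rw [planeProj_apply, hx0]; simp
    refine hlim x 1 ?_
    rw [h2]
    exact tendsto_measureReal_one hmom ⟨by linarith [hx.1], by linarith [hx.2]⟩ hx
  · rw [hI] at hx hω
    rw [hfx, hum _ hx, (hmom _ hx).ext (hω.hasChebMoments hn),
      measureReal_map_re_Icc (planeProj n).continuous.measurable hω.ae_mem_slit, hJtld]
    simp only [planeProj_re, planeProj_im]
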